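/- arXiv:2003.06200 — 2 statements merged into one kernel-verified Lean document; each statement's English description precedes it below -/
import Mathlib

section
/- Let c_H = sqrt(2H / ((1-2H)·B(1-2H, H+1/2))) where B is the Beta function, and define for 0 < s < t the kernel K_H(t,s) = c_H [ (t/s)^{H-1/2}(t-s)^{H-1/2} + (1/2 - H) s^{1/2-H} ∫_s^t u^{H-3/2}(u-s)^{H-1/2} du ]. Then for a standard fractional Brownian motion with Hurst parameter H ∈ (0,1/2), the covariance R_H(t,s) = (1/2)(t^{2H} + s^{2H} - |t-s|^{2H}) admits the representation R_H(t,s) = ∫_0^{t∧s} K_H(t,u) K_H(s,u) du. -/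
open MeasureTheory Set

/-- The real Beta function `B(x,y) = ∫₀¹ u^{x-1}(1-u)^{y-1} du`. -/
noncomputable def betaFn (x y : ℝ) : ℝ :=
  ∫ u in Ioo (0 : ℝ) 1, u ^ (x - 1) * (1 - u) ^ (y - 1)

/-- The constant `c_H = √(2H/((1-2H)·B(1-2H, H+1/2)))`. -/
noncomputable def cH (H : ℝ) : ℝ :=
  Real.sqrt (2 * H / ((1 - 2 * H) * betaFn (1 - 2 * H) (H + 1 / 2)))

/-- The Volterra kernel `K_H(t,s)` of fractional Brownian motion, for `0 < s < t`. -/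
noncomputable def KH (H t s : ℝ) : ℝ :=
  cH H * ((t / s) ^ (H - 1 / 2) * (t - s) ^ (H - 1 / 2) +
    (1 / 2 - H) * s ^ (1 / 2 - H) *
      ∫ u in Ioo s t, u ^ (H - 3 / 2) * (u - s) ^ (H - 1 / 2))

open scoped ENNReal
open Filter Topology

theorem setLIntegral_Ioo_ofReal_of_hasDerivAt {F f : ℝ → ℝ} {x y : ℝ} (hxy : x ≤ y)
    (hcont : ContinuousOn F (Icc x y)) (hderiv : ∀ z ∈ Ioo x y, HasDerivAt F (f z) z)
    (hnonneg : ∀ z ∈ Ioo x y, 0 ≤ f z) :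
    ∫⁻ z in Ioo x y, ENNReal.ofReal (f z) = ENNReal.ofReal (F y - F x) := by
  have hint : IntegrableOn f (Ioc x y) :=
    intervalIntegral.integrableOn_deriv_of_nonneg hcont hderiv hnonneg
  rw [← intervalIntegral.integral_eq_sub_of_hasDerivAt_of_le hxy hcont hderiv
      ((intervalIntegrable_iff_integrableOn_Ioc_of_le hxy).2 hint),
    intervalIntegral.integral_of_le hxy, integral_Ioc_eq_integral_Ioo,
    ofReal_integral_eq_lintegral_ofReal (hint.mono_set Ioo_subset_Ioc_self)]
  exact (ae_restrict_iff' measurableSet_Ioo).2 (ae_of_all _ hnonneg)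

theorem setLIntegral_Ioi_ofReal_of_hasDerivAt {F f : ℝ → ℝ} {x l : ℝ}
    (hcont : ContinuousWithinAt F (Ici x) x) (hderiv : ∀ z ∈ Ioi x, HasDerivAt F (f z) z)
    (hnonneg : ∀ z ∈ Ioi x, 0 ≤ f z) (hlim : Tendsto F atTop (𝓝 l)) :
    ∫⁻ z in Ioi x, ENNReal.ofReal (f z) = ENNReal.ofReal (l - F x) := by
  rw [← integral_Ioi_of_hasDerivAt_of_nonneg hcont hderiv hnonneg hlim,
    ofReal_integral_eq_lintegral_ofReal
      (integrableOn_Ioi_deriv_of_nonneg hcont hderiv hnonneg hlim)]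
  exact (ae_restrict_iff' measurableSet_Ioi).2 (ae_of_all _ hnonneg)

theorem measurable_setLIntegral_Ioo {f : ℝ → ℝ → ℝ≥0∞} (hf : Measurable (Function.uncurry f))
    (r : ℝ) : Measurable fun x => ∫⁻ y in Ioo x r, f x y := by
  have hS : MeasurableSet {p : ℝ × ℝ | p.1 < p.2 ∧ p.2 < r} :=
    (measurableSet_lt measurable_fst measurable_snd).inter
      (measurableSet_lt measurable_snd measurable_const)
  convert (hf.indicator hS).lintegral_prod_right' (ν := volume) using 2 with x
  rw [← lintegral_indicator measurableSet_Ioo]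
  refine lintegral_congr fun y => ?_
  by_cases hy : y ∈ Ioo x r
  · rw [indicator_of_mem hy,
      indicator_of_mem (show (x, y) ∈ {p : ℝ × ℝ | p.1 < p.2 ∧ p.2 < r} from hy),
      Function.uncurry_apply_pair]
  · rw [indicator_of_notMem hy,
      indicator_of_notMem (show (x, y) ∉ {p : ℝ × ℝ | p.1 < p.2 ∧ p.2 < r} from hy)]

/-- The Tonelli theorem on the triangle `0 < x < y < r`. -/
theorem setLIntegral_Ioo_triangle_swap {f : ℝ → ℝ → ℝ≥0∞} (hf : Measurable (Function.uncurry f))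
    (r : ℝ) :
    ∫⁻ x in Ioo 0 r, ∫⁻ y in Ioo x r, f x y = ∫⁻ y in Ioo 0 r, ∫⁻ x in Ioo 0 y, f x y := by
  have hS : MeasurableSet {p : ℝ × ℝ | 0 < p.1 ∧ p.1 < p.2 ∧ p.2 < r} :=
    (measurableSet_lt measurable_const measurable_fst).inter
      ((measurableSet_lt measurable_fst measurable_snd).inter
        (measurableSet_lt measurable_snd measurable_const))
  have h := lintegral_lintegral_swap (μ := (volume : Measure ℝ)) (ν := (volume : Measure ℝ))
    (f := fun x y => indicator {p : ℝ × ℝ | 0 < p.1 ∧ p.1 < p.2 ∧ p.2 < r} (Function.uncurry f)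
      (x, y)) (hf.indicator hS).aemeasurable
  convert h using 1
  · rw [← lintegral_indicator measurableSet_Ioo]
    refine lintegral_congr fun x => ?_
    by_cases hx : x ∈ Ioo 0 r
    · rw [indicator_of_mem hx, ← lintegral_indicator measurableSet_Ioo]
      refine lintegral_congr fun y => ?_
      simp only [indicator, mem_Ioo, mem_ofPred_eq, hx.1, true_and, Function.uncurry_apply_pair]
    · rw [indicator_of_notMem hx, eq_comm, lintegral_eq_zero_of_ae_eq_zero]
      refine ae_of_all _ fun y => indicator_of_notMem ?_ _
      rintro ⟨h0, hxy, hy⟩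
      exact hx ⟨h0, hxy.trans hy⟩
  · rw [← lintegral_indicator measurableSet_Ioo]
    refine lintegral_congr fun y => ?_
    by_cases hy : y ∈ Ioo 0 r
    · rw [indicator_of_mem hy, ← lintegral_indicator measurableSet_Ioo]
      refine lintegral_congr fun x => ?_
      simp only [indicator, mem_Ioo, mem_ofPred_eq, hy.2, and_true, Function.uncurry_apply_pair]
    · rw [indicator_of_notMem hy, eq_comm, lintegral_eq_zero_of_ae_eq_zero]
      refine ae_of_all _ fun x => indicator_of_notMem ?_ _
      rintro ⟨h0, hxy, hr⟩
      exact hy ⟨h0.trans hxy, hr⟩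

theorem setLIntegral_rpow_mul_one_sub_rpow {x y : ℝ} (hx : 0 < x) (hy : 0 < y) :
    ∫⁻ u in Ioo (0 : ℝ) 1, ENNReal.ofReal (u ^ (x - 1) * (1 - u) ^ (y - 1)) =
      ENNReal.ofReal (ProbabilityTheory.beta x y) := by
  have hpos := ProbabilityTheory.beta_pos hx hy
  have h := ProbabilityTheory.lintegral_betaPDF_eq_one hx hy
  simp_rw [ProbabilityTheory.lintegral_betaPDF, mul_assoc,
    ENNReal.ofReal_mul (one_div_nonneg.2 hpos.le)] at h
  rw [lintegral_const_mul _ (by fun_prop)] at h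
  have hone : ENNReal.ofReal (ProbabilityTheory.beta x y) *
      ENNReal.ofReal (1 / ProbabilityTheory.beta x y) = 1 := by
    rw [← ENNReal.ofReal_mul hpos.le, mul_one_div_cancel hpos.ne', ENNReal.ofReal_one]
  rw [← one_mul (∫⁻ _ in _, _), ← hone, mul_assoc, h, mul_one]

theorem betaFn_eq_beta {x y : ℝ} (hx : 0 < x) (hy : 0 < y) :
    betaFn x y = ProbabilityTheory.beta x y := by
  rw [betaFn, integral_eq_lintegral_of_nonneg_ae, setLIntegral_rpow_mul_one_sub_rpow hx hy,
    ENNReal.toReal_ofReal (ProbabilityTheory.beta_pos hx hy).le]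
  · refine (ae_restrict_iff' measurableSet_Ioo).2 (ae_of_all _ fun u hu => ?_)
    exact mul_nonneg (Real.rpow_nonneg hu.1.le _) (Real.rpow_nonneg (sub_nonneg.2 hu.2.le) _)
  · exact Measurable.aestronglyMeasurable (by fun_prop)

theorem beta_add_one_left {x y : ℝ} (hx : 0 < x) (hy : 0 < y) :
    (x + y) * ProbabilityTheory.beta (x + 1) y = x * ProbabilityTheory.beta x y := by
  have := (Real.Gamma_pos_of_pos (add_pos hx hy)).ne'
  have hxy := (add_pos hx hy).ne'
  rw [ProbabilityTheory.beta, ProbabilityTheory.beta, Real.Gamma_add_one hx.ne', add_right_comm,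
    Real.Gamma_add_one hxy]
  field_simp

/-- The kernel `K_H(t,u) / c_H`, with `a = 1/2 - H`, as an extended nonnegative real. -/
noncomputable def lKernel (a t u : ℝ) : ℝ≥0∞ :=
  ENNReal.ofReal (t ^ (-a) * u ^ a * (t - u) ^ (-a)) +
    ∫⁻ v in Ioo u t, ENNReal.ofReal (a * u ^ a * v ^ (-a - 1) * (v - u) ^ (-a))

theorem measurable_lKernel (a t : ℝ) : Measurable (lKernel a t) := by
  refine Measurable.add (by fun_prop) (measurable_setLIntegral_Ioo ?_ t)
  fun_prop

theorem setLIntegral_Ioi_deriv_rpow_mul_rpow {a t u : ℝ} (ha : 0 < a) (hu : 0 < u) (hut : u < t) :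
    ∫⁻ r in Ioi t, ENNReal.ofReal
        (a * u ^ a * r ^ (-a - 1) * (r - u) ^ (-a) + a * u ^ a * r ^ (-a) * (r - u) ^ (-a - 1)) =
      ENNReal.ofReal (t ^ (-a) * u ^ a * (t - u) ^ (-a)) := by
  have hderiv : ∀ r ∈ Ici t, HasDerivAt (fun r => -(u ^ a * r ^ (-a) * (r - u) ^ (-a)))
      (a * u ^ a * r ^ (-a - 1) * (r - u) ^ (-a) + a * u ^ a * r ^ (-a) * (r - u) ^ (-a - 1)) r := by
    intro r hr
    have hur : u < r := hut.trans_le hr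
    have h1 := (hasDerivAt_id r).rpow_const (p := -a) (Or.inl (hu.trans hur).ne')
    have h2 := ((hasDerivAt_id r).sub_const u).rpow_const (p := -a) (Or.inl (sub_pos.2 hur).ne')
    refine ((h1.const_mul (u ^ a)).mul h2).neg.congr_deriv ?_
    simp only [id]
    ring
  have hlim : Tendsto (fun r => -(u ^ a * r ^ (-a) * (r - u) ^ (-a))) atTop (𝓝 0) := by
    have h1 := tendsto_rpow_neg_atTop ha
    have h2 := h1.comp (tendsto_atTop_add_const_right atTop (-u) tendsto_id)
    simpa [Function.comp_def, ← sub_eq_add_neg] using ((h1.const_mul (u ^ a)).mul h2).neg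
  rw [setLIntegral_Ioi_ofReal_of_hasDerivAt
    (hderiv t self_mem_Ici).continuousAt.continuousWithinAt
    (fun r hr => hderiv r (mem_Ici.2 (le_of_lt hr))) (fun r hr => ?_) hlim]
  · congr 1
    ring
  · have hur : 0 < r - u := sub_pos.2 (hut.trans hr)
    have hr0 : 0 < r := hu.trans (hut.trans hr)
    positivity

theorem setLIntegral_Ioi_rpow_mul_sub_rpow {a u : ℝ} (ha : 0 < a) (ha1 : a < 1) (hu : 0 < u) :
    ∫⁻ v in Ioi u, ENNReal.ofReal (a * u ^ a * v ^ (-a - 1) * (v - u) ^ (-a)) =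
      ENNReal.ofReal (a * ProbabilityTheory.beta (2 * a) (1 - a)) * ENNReal.ofReal (u ^ (-a)) := by
  have himage : (fun x : ℝ => u / x) '' Ioo 0 1 = Ioi u := by
    ext v
    constructor
    · rintro ⟨x, hx, rfl⟩
      exact (lt_div_iff₀ hx.1).2 (mul_lt_of_lt_one_right hu hx.2)
    · intro hv
      have hv0 : 0 < v := hu.trans hv
      exact ⟨u / v, ⟨div_pos hu hv0, (div_lt_one hv0).2 hv⟩, div_div_cancel₀ hu.ne'⟩
  have hinj : InjOn (fun x : ℝ => u / x) (Ioo 0 1) := by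
    intro x hx y hy hxy
    exact inv_injective (mul_left_cancel₀ hu.ne' (by simpa [div_eq_mul_inv] using hxy))
  have hderiv : ∀ x ∈ Ioo (0 : ℝ) 1,
      HasDerivWithinAt (fun x : ℝ => u / x) (-u / x ^ 2) (Ioo 0 1) x := by
    intro x hx
    refine (((hasDerivAt_const x u).div (hasDerivAt_id x) hx.1.ne').congr_deriv
      ?_).hasDerivWithinAt
    simp
  have hbeta : 0 < a * ProbabilityTheory.beta (2 * a) (1 - a) :=
    mul_pos ha (ProbabilityTheory.beta_pos (by linarith) (by linarith))
  rw [← himage, lintegral_image_eq_lintegral_abs_deriv_mul measurableSet_Ioo hderiv hinj,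
    ENNReal.ofReal_mul ha.le, mul_right_comm, ← ENNReal.ofReal_mul ha.le,
    ← setLIntegral_rpow_mul_one_sub_rpow (by linarith) (by linarith),
    ← lintegral_const_mul _ (by fun_prop)]
  refine setLIntegral_congr_fun measurableSet_Ioo fun x hx => ?_
  have hx0 := hx.1
  have hx1 : 0 < 1 - x := sub_pos.2 hx.2
  have hsub : u / x - u = u * (1 - x) / x := by field_simp
  rw [← ENNReal.ofReal_mul (abs_nonneg _), ← ENNReal.ofReal_mul (by positivity), hsub]
  congr 1
  have habs : |-u / x ^ 2| = u ^ (1 : ℝ) * x ^ (-2 : ℝ) := by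
    rw [abs_div, abs_neg, abs_of_pos hu, abs_of_pos (by positivity), Real.rpow_one,
      Real.rpow_neg hx0.le, div_eq_mul_inv]
    norm_cast
  rw [habs, Real.div_rpow hu.le hx0.le, Real.div_rpow (by positivity) hx0.le,
    Real.mul_rpow hu.le hx1.le]
  have : a * u ^ (-a) * (x ^ (2 * a - 1) * (1 - x) ^ (1 - a - 1)) =
      a * (u ^ (-a) * (x ^ (2 * a - 1) * (1 - x) ^ (1 - a - 1))) := by ring
  rw [this, show ∀ p q r s t w y z : ℝ, p * q * (a * r * (s / t) * (w * y / z)) =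
    a * (p * q * (r * (s / t) * (w * y / z))) from fun _ _ _ _ _ _ _ _ => by ring]
  congr 1
  simp only [Real.rpow_def_of_pos hu, Real.rpow_def_of_pos hx0, Real.rpow_def_of_pos hx1,
    ← Real.exp_add, ← Real.exp_sub]
  congr 1
  ring

theorem lKernel_eq_add_setLIntegral_Ioi {a t u : ℝ} (ha : 0 < a) (ha1 : a < 1) (hu : 0 < u)
    (hut : u < t) :
    lKernel a t u = ENNReal.ofReal (a * ProbabilityTheory.beta (2 * a) (1 - a)) *
        ENNReal.ofReal (u ^ (-a)) +
      ∫⁻ r in Ioi t, ENNReal.ofReal (a * u ^ a * r ^ (-a) * (r - u) ^ (-a - 1)) := by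
  have hsplit : ∫⁻ v in Ioi u, ENNReal.ofReal (a * u ^ a * v ^ (-a - 1) * (v - u) ^ (-a)) =
      (∫⁻ v in Ioo u t, ENNReal.ofReal (a * u ^ a * v ^ (-a - 1) * (v - u) ^ (-a))) +
      ∫⁻ v in Ioi t, ENNReal.ofReal (a * u ^ a * v ^ (-a - 1) * (v - u) ^ (-a)) := by
    rw [← Ioc_union_Ioi_eq_Ioi hut.le, lintegral_union measurableSet_Ioi
      (Ioc_disjoint_Ioi le_rfl), ← restrict_Ioo_eq_restrict_Ioc]
  rw [lKernel, ← setLIntegral_Ioi_deriv_rpow_mul_rpow ha hu hut,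
    ← setLIntegral_Ioi_rpow_mul_sub_rpow ha ha1 hu, hsplit, add_comm, add_assoc]
  congr 1
  rw [← lintegral_add_left (by fun_prop)]
  refine setLIntegral_congr_fun measurableSet_Ioi fun r hr => ?_
  have hur : 0 < r - u := sub_pos.2 (hut.trans hr)
  have hr0 : 0 < r := hu.trans (hut.trans hr)
  exact ENNReal.ofReal_add (by positivity) (by positivity)

theorem ofReal_KH {H t u : ℝ} (hH0 : 0 < H) (hH : H < 1 / 2) (hu : 0 < u) (hut : u < t) :
    ENNReal.ofReal (KH H t u) = ENNReal.ofReal (cH H) * lKernel (1 / 2 - H) t u := by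
  have ht := hu.trans hut
  have hcH : 0 ≤ cH H := Real.sqrt_nonneg _
  have htu : 0 < t - u := sub_pos.2 hut
  set a := 1 / 2 - H with ha_def
  have ha : 0 < a := by linarith
  have hnn : ∀ v ∈ Ioo u t, 0 ≤ a * u ^ a * (v ^ (-a - 1) * (v - u) ^ (-a)) := by
    intro v hv
    have h1 : 0 < v := hu.trans hv.1
    have h2 : 0 < v - u := sub_pos.2 hv.1
    positivity
  have hint : IntegrableOn (fun v => a * u ^ a * (v ^ (-a - 1) * (v - u) ^ (-a))) (Ioo u t) := by
    refine ⟨Measurable.aestronglyMeasurable (by fun_prop), ?_⟩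
    rw [hasFiniteIntegral_iff_ofReal ((ae_restrict_iff' measurableSet_Ioo).2 (ae_of_all _ hnn))]
    simp only [← mul_assoc]
    refine (lintegral_mono_set Ioo_subset_Ioi_self).trans_lt ?_
    rw [setLIntegral_Ioi_rpow_mul_sub_rpow ha (by linarith) hu]
    exact ENNReal.mul_lt_top ENNReal.ofReal_lt_top ENNReal.ofReal_lt_top
  have hexp : H - 1 / 2 = -a := by ring
  have hexp' : H - 3 / 2 = -a - 1 := by rw [ha_def]; ring
  rw [KH, hexp, hexp', ENNReal.ofReal_mul hcH, lKernel, ← ha_def, ← integral_const_mul,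
    ENNReal.ofReal_add (by positivity) (setIntegral_nonneg measurableSet_Ioo hnn),
    ofReal_integral_eq_lintegral_ofReal hint
      ((ae_restrict_iff' measurableSet_Ioo).2 (ae_of_all _ hnn)),
    Real.div_rpow ht.le hu.le, Real.rpow_neg hu.le a, div_inv_eq_mul]
  simp only [← mul_assoc]

theorem KH_nonneg {H t u : ℝ} (hH : H < 1 / 2) (hu : 0 < u) (hut : u < t) :
    0 ≤ KH H t u := by
  have ha : 0 < 1 / 2 - H := by linarith
  have htu : 0 < t - u := sub_pos.2 hut
  have ht := hu.trans hut
  have hint : 0 ≤ ∫ v in Ioo u t, v ^ (H - 3 / 2) * (v - u) ^ (H - 1 / 2) := by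
    refine setIntegral_nonneg measurableSet_Ioo fun v hv => ?_
    exact mul_nonneg (Real.rpow_nonneg (hu.trans hv.1).le _)
      (Real.rpow_nonneg (sub_pos.2 hv.1).le _)
  have hcH : 0 ≤ cH H := Real.sqrt_nonneg _
  rw [KH]
  positivity

/-- If `ψ` is the derivative of the Abel transform `v ↦ ∫₀ᵛ h(u)(v-u)^{-a} du`, then pairing
`h(u)u^{-a}` with the kernel is the same as pairing `y^{-a}` with `ψ`. -/
theorem setLIntegral_mul_lKernel {a s : ℝ} (ha : 0 < a) (hs : 0 < s) {h ψ : ℝ → ℝ≥0∞}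
    (hh : Measurable h) (hψ : Measurable ψ)
    (habel : ∀ v ∈ Ioc 0 s, ∫⁻ u in Ioo 0 v, h u * ENNReal.ofReal ((v - u) ^ (-a)) =
      ∫⁻ y in Ioo 0 v, ψ y) :
    ∫⁻ u in Ioo 0 s, h u * ENNReal.ofReal (u ^ (-a)) * lKernel a s u =
      ∫⁻ y in Ioo 0 s, ENNReal.ofReal (y ^ (-a)) * ψ y := by
  have hleft : ∀ u ∈ Ioo 0 s, h u * ENNReal.ofReal (u ^ (-a)) * lKernel a s u =
      ENNReal.ofReal (s ^ (-a)) * (h u * ENNReal.ofReal ((s - u) ^ (-a))) +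
      ∫⁻ v in Ioo u s, ENNReal.ofReal (a * v ^ (-a - 1)) *
        (h u * ENNReal.ofReal ((v - u) ^ (-a))) := by
    intro u hu
    have hua : u ^ (-a) * u ^ a = 1 := by
      rw [← Real.rpow_add hu.1, neg_add_cancel, Real.rpow_zero]
    have hu' : 0 ≤ u ^ (-a) := Real.rpow_nonneg hu.1.le _
    rw [lKernel, mul_add, ← lintegral_const_mul _ (by fun_prop)]
    congr 1
    · rw [mul_assoc, ← ENNReal.ofReal_mul hu', mul_left_comm (ENNReal.ofReal _),
        ← ENNReal.ofReal_mul (Real.rpow_nonneg hs.le _)]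
      congr 2
      linear_combination s ^ (-a) * (s - u) ^ (-a) * hua
    · refine setLIntegral_congr_fun measurableSet_Ioo fun v hv => ?_
      have hv0 : 0 < v := hu.1.trans hv.1
      rw [mul_assoc, ← ENNReal.ofReal_mul hu', mul_left_comm (ENNReal.ofReal _),
        ← ENNReal.ofReal_mul (by positivity)]
      congr 2
      linear_combination a * v ^ (-a - 1) * (v - u) ^ (-a) * hua
  have hright : ∀ y ∈ Ioo 0 s, ENNReal.ofReal (s ^ (-a)) * ψ y +
      ∫⁻ v in Ioo y s, ENNReal.ofReal (a * v ^ (-a - 1)) * ψ y =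
      ENNReal.ofReal (y ^ (-a)) * ψ y := by
    intro y hy
    have hderiv : ∀ v ∈ Icc y s, HasDerivAt (fun v => -v ^ (-a)) (a * v ^ (-a - 1)) v := by
      intro v hv
      refine (((hasDerivAt_id v).rpow_const
        (Or.inl (hy.1.trans_le hv.1).ne')).neg).congr_deriv ?_
      simp only [id]
      ring
    rw [lintegral_mul_const _ (by fun_prop), setLIntegral_Ioo_ofReal_of_hasDerivAt hy.2.le
      (fun v hv => (hderiv v hv).continuousAt.continuousWithinAt)
      (fun v hv => hderiv v (Ioo_subset_Icc_self hv))
      (fun v hv => mul_nonneg ha.le (Real.rpow_nonneg (hy.1.trans hv.1).le _)), ← add_mul,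
      ← ENNReal.ofReal_add (Real.rpow_nonneg hs.le _)]
    · congr 2
      ring
    · have := Real.rpow_le_rpow_of_nonpos hy.1 hy.2.le (neg_nonpos.2 ha.le)
      linarith
  have hmeas : Measurable (Function.uncurry fun u v : ℝ =>
      ENNReal.ofReal (a * v ^ (-a - 1)) * (h u * ENNReal.ofReal ((v - u) ^ (-a)))) := by
    simp only [Function.uncurry_def]
    fun_prop
  have hmeas' : Measurable (Function.uncurry fun y v : ℝ =>
      ENNReal.ofReal (a * v ^ (-a - 1)) * ψ y) := by
    simp only [Function.uncurry_def]
    fun_prop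
  rw [setLIntegral_congr_fun measurableSet_Ioo hleft, lintegral_add_left (by fun_prop),
    setLIntegral_Ioo_triangle_swap hmeas, lintegral_const_mul _ (by fun_prop),
    habel s ⟨hs, le_rfl⟩, ← setLIntegral_congr_fun measurableSet_Ioo hright,
    lintegral_add_left (by fun_prop), lintegral_const_mul _ (by fun_prop),
    setLIntegral_Ioo_triangle_swap hmeas']
  congr 1
  refine setLIntegral_congr_fun measurableSet_Ioo fun v hv => ?_
  rw [lintegral_const_mul _ (by fun_prop), lintegral_const_mul _ (by fun_prop),
    habel v ⟨hv.1, hv.2.le⟩]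

theorem setLIntegral_mobius {a r w : ℝ} (ha : 0 < a) (ha1 : a < 1) (hw : 0 < w) (hwr : w < r) :
    ∫⁻ x in Ioo (0 : ℝ) 1, ENNReal.ofReal (x ^ (2 * a) * (1 - x) ^ (-a) * (r - w * x) ^ (-a - 2)) =
      ENNReal.ofReal (r ^ (a - 1) * (r - w) ^ (-2 * a - 1)) *
        ENNReal.ofReal (ProbabilityTheory.beta (2 * a + 1) (1 - a)) := by
  have hr : 0 < r := hw.trans hwr
  have hrw : 0 < r - w := sub_pos.2 hwr
  have hden : ∀ x < 1, 0 < r - w * x := fun x hx => by nlinarith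
  have himage : (fun x : ℝ => x * (r - w) / (r - w * x)) '' Ioo 0 1 = Ioo 0 1 := by
    ext y
    constructor
    · rintro ⟨x, hx, rfl⟩
      have hd := hden x hx.2
      refine ⟨div_pos (mul_pos hx.1 hrw) hd, (div_lt_one hd).2 ?_⟩
      nlinarith [hx.2]
    · intro hy
      have hd : 0 < r - w + w * y := add_pos hrw (mul_pos hw hy.1)
      refine ⟨y * r / (r - w + w * y), ⟨div_pos (mul_pos hy.1 hr) hd, (div_lt_one hd).2 ?_⟩, ?_⟩
      · nlinarith [hy.2]
      · have : r - w * (y * r / (r - w + w * y)) = r * (r - w) / (r - w + w * y) := by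
          field_simp
          ring
        simp only [this]
        rw [div_mul_eq_mul_div, div_div_div_cancel_right₀ hd.ne', mul_assoc,
          mul_div_cancel_right₀ _ (mul_pos hr hrw).ne']
  have hinj : InjOn (fun x : ℝ => x * (r - w) / (r - w * x)) (Ioo 0 1) := by
    intro x hx y hy hxy
    have h1 := hden x hx.2
    have h2 := hden y hy.2
    rw [div_eq_div_iff h1.ne' h2.ne'] at hxy
    have : (r - w) * r * (x - y) = 0 := by linear_combination hxy
    exact sub_eq_zero.1 ((mul_eq_zero.1 this).resolve_left (mul_pos hrw hr).ne')
  have hderiv : ∀ x ∈ Ioo (0 : ℝ) 1, HasDerivWithinAt (fun x : ℝ => x * (r - w) / (r - w * x))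
      ((r - w) * r / (r - w * x) ^ 2) (Ioo 0 1) x := by
    intro x hx
    refine ((((hasDerivAt_id x).mul_const (r - w)).div
      (((hasDerivAt_id x).const_mul w).const_sub r) (hden x hx.2).ne').congr_deriv
      ?_).hasDerivWithinAt
    simp only [id]
    ring
  rw [← setLIntegral_rpow_mul_one_sub_rpow (by linarith) (by linarith)]
  conv_rhs => rw [← himage]
  rw [lintegral_image_eq_lintegral_abs_deriv_mul measurableSet_Ioo hderiv hinj,
    ← lintegral_const_mul' _ _ ENNReal.ofReal_ne_top]
  refine setLIntegral_congr_fun measurableSet_Ioo fun x hx => ?_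
  have hx0 := hx.1
  have hx1 : 0 < 1 - x := sub_pos.2 hx.2
  have hd := hden x hx.2
  have hsub : 1 - x * (r - w) / (r - w * x) = r * (1 - x) / (r - w * x) := by
    rw [eq_div_iff hd.ne', sub_mul, div_mul_cancel₀ _ hd.ne']
    ring
  have habs : |(r - w) * r / (r - w * x) ^ 2| =
      (r - w) ^ (1 : ℝ) * r ^ (1 : ℝ) * (r - w * x) ^ (-2 : ℝ) := by
    rw [abs_of_pos (by positivity), Real.rpow_one, Real.rpow_one, Real.rpow_neg hd.le,
      div_eq_mul_inv]
    norm_cast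
  rw [← ENNReal.ofReal_mul (abs_nonneg _), ← ENNReal.ofReal_mul (by positivity), hsub, habs]
  congr 1
  rw [Real.div_rpow (by positivity) hd.le, Real.div_rpow (by positivity) hd.le,
    Real.mul_rpow hr.le hx1.le, Real.mul_rpow hx0.le hrw.le]
  simp only [Real.rpow_def_of_pos hr, Real.rpow_def_of_pos hrw, Real.rpow_def_of_pos hx0,
    Real.rpow_def_of_pos hx1, Real.rpow_def_of_pos hd, ← Real.exp_add, ← Real.exp_sub]
  congr 1
  ring

theorem setLIntegral_Ioo_rescale {v : ℝ} (hv : 0 < v) (g : ℝ → ℝ≥0∞) :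
    ∫⁻ u in Ioo 0 v, g u = ∫⁻ x in Ioo (0 : ℝ) 1, ENNReal.ofReal v * g (v * x) := by
  have himage : (fun x : ℝ => v * x) '' Ioo 0 1 = Ioo 0 v := by
    rw [image_mul_left_Ioo hv, mul_zero, mul_one]
  rw [← himage, lintegral_image_eq_lintegral_abs_deriv_mul measurableSet_Ioo
    (f' := fun _ => v * 1) (fun x _ => ((hasDerivAt_id' x).const_mul v).hasDerivWithinAt)
    (mul_right_injective₀ hv.ne').injOn]
  simp [abs_of_pos hv]

theorem abelTransform_rpow_mul_rpow {a r v : ℝ} (ha : 0 < a) (ha1 : a < 1) (hv : 0 < v)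
    (hvr : v < r) :
    ∫⁻ u in Ioo 0 v, ENNReal.ofReal (u ^ (2 * a) * (r - u) ^ (-a - 1)) *
        ENNReal.ofReal ((v - u) ^ (-a)) =
      ∫⁻ y in Ioo 0 v, ENNReal.ofReal (2 * a * ProbabilityTheory.beta (2 * a) (1 - a) *
        r ^ a * y ^ a * (r - y) ^ (-2 * a - 1)) := by
  have hr : 0 < r := hv.trans hvr
  have hinner : ∀ x ∈ Ioo (0 : ℝ) 1, ∫⁻ w in Ioo 0 v,
      ENNReal.ofReal ((1 + a) * r * w ^ a * (r - w * x) ^ (-a - 2)) =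
      ENNReal.ofReal (v ^ (1 + a) * (r - v * x) ^ (-a - 1)) := by
    intro x hx
    have hpos : ∀ w ∈ Icc 0 v, 0 < r - w * x := fun w hw => by
      nlinarith [hx.1, hx.2, hw.1, hw.2, mul_le_mul hw.2 hx.2.le hx.1.le hv.le]
    rw [setLIntegral_Ioo_ofReal_of_hasDerivAt
      (F := fun w => w ^ (1 + a) * (r - w * x) ^ (-a - 1)) hv.le]
    · rw [Real.zero_rpow (by linarith), zero_mul, sub_zero]
    · refine ContinuousOn.mul (Real.continuous_rpow_const (by linarith)).continuousOn ?_
      exact ContinuousOn.rpow_const (by fun_prop) fun w hw => Or.inl (hpos w hw).ne'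
    · intro w hw
      have hw' := hpos w (Ioo_subset_Icc_self hw)
      refine (((hasDerivAt_id w).rpow_const (p := 1 + a) (Or.inl hw.1.ne')).mul
        ((((hasDerivAt_id w).mul_const x).const_sub r).rpow_const (p := -a - 1)
          (Or.inl hw'.ne'))).congr_deriv ?_
      simp only [id]
      rw [show -a - 1 - 1 = -a - 2 by ring, show 1 + a - 1 = a by ring,
        show -a - 1 = -a - 2 + 1 by ring, Real.rpow_add_one hw'.ne',
        add_comm 1 a, Real.rpow_add_one hw.1.ne']
      ring
    · intro w hw
      have hw' := hpos w (Ioo_subset_Icc_self hw)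
      have := hw.1
      positivity
  have hmeas : Measurable (Function.uncurry fun w x : ℝ =>
      ENNReal.ofReal (x ^ (2 * a) * (1 - x) ^ (-a)) *
        ENNReal.ofReal ((1 + a) * r * w ^ a * (r - w * x) ^ (-a - 2))) := by
    simp only [Function.uncurry_def]
    fun_prop
  calc
    _ = ∫⁻ x in Ioo (0 : ℝ) 1, ENNReal.ofReal (x ^ (2 * a) * (1 - x) ^ (-a)) *
          ENNReal.ofReal (v ^ (1 + a) * (r - v * x) ^ (-a - 1)) := by
      rw [setLIntegral_Ioo_rescale hv]
      refine setLIntegral_congr_fun measurableSet_Ioo fun x hx => ?_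
      have hx0 := hx.1
      have hx1 : 0 < 1 - x := sub_pos.2 hx.2
      have hd : 0 < r - v * x := by nlinarith
      rw [← ENNReal.ofReal_mul (by positivity), ← ENNReal.ofReal_mul hv.le,
        ← ENNReal.ofReal_mul (by positivity), show v - v * x = v * (1 - x) by ring,
        Real.mul_rpow hv.le hx0.le, Real.mul_rpow hv.le hx1.le]
      congr 1
      have : v * v ^ (2 * a) * v ^ (-a) = v ^ (1 + a) := by
        nth_rewrite 1 [← Real.rpow_one v]
        rw [← Real.rpow_add hv, ← Real.rpow_add hv]
        congr 1
        ring
      rw [← this]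
      ring
    _ = ∫⁻ x in Ioo (0 : ℝ) 1, ∫⁻ w in Ioo 0 v,
          ENNReal.ofReal (x ^ (2 * a) * (1 - x) ^ (-a)) *
          ENNReal.ofReal ((1 + a) * r * w ^ a * (r - w * x) ^ (-a - 2)) := by
      refine setLIntegral_congr_fun measurableSet_Ioo fun x hx => ?_
      rw [lintegral_const_mul _ (by fun_prop), hinner x hx]
    _ = ∫⁻ w in Ioo 0 v, ∫⁻ x in Ioo (0 : ℝ) 1,
          ENNReal.ofReal (x ^ (2 * a) * (1 - x) ^ (-a)) *
          ENNReal.ofReal ((1 + a) * r * w ^ a * (r - w * x) ^ (-a - 2)) :=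
      (lintegral_lintegral_swap hmeas.aemeasurable).symm
    _ = _ := by
      refine setLIntegral_congr_fun measurableSet_Ioo fun w hw => ?_
      have hw0 := hw.1
      have hrw : 0 < r - w := sub_pos.2 (hw.2.trans hvr)
      have hC : 0 ≤ (1 + a) * r * w ^ a := by positivity
      have hcongr : ∀ x ∈ Ioo (0 : ℝ) 1, ENNReal.ofReal (x ^ (2 * a) * (1 - x) ^ (-a)) *
          ENNReal.ofReal ((1 + a) * r * w ^ a * (r - w * x) ^ (-a - 2)) =
          ENNReal.ofReal ((1 + a) * r * w ^ a) *
          ENNReal.ofReal (x ^ (2 * a) * (1 - x) ^ (-a) * (r - w * x) ^ (-a - 2)) := by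
        intro x hx
        have hx0 := hx.1
        have hx1 : 0 < 1 - x := sub_pos.2 hx.2
        rw [← ENNReal.ofReal_mul (by positivity), ← ENNReal.ofReal_mul hC]
        congr 1
        ring
      rw [setLIntegral_congr_fun measurableSet_Ioo hcongr, lintegral_const_mul _ (by fun_prop),
        setLIntegral_mobius ha ha1 hw0 (hw.2.trans hvr), ← ENNReal.ofReal_mul (by positivity),
        ← ENNReal.ofReal_mul hC]
      congr 1
      have hbeta := beta_add_one_left (x := 2 * a) (y := 1 - a) (by linarith) (by linarith)
      have hra : r * r ^ (a - 1) = r ^ a := by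
        rw [mul_comm, ← Real.rpow_add_one hr.ne', sub_add_cancel]
      rw [← hra]
      linear_combination r * r ^ (a - 1) * w ^ a * (r - w) ^ (-2 * a - 1) * hbeta

theorem setLIntegral_rpow_neg_mul_lKernel {a s : ℝ} (ha : 0 < a) (ha1 : a < 1 / 2) (hs : 0 < s) :
    ∫⁻ u in Ioo 0 s, ENNReal.ofReal (u ^ (-a)) * lKernel a s u =
      ENNReal.ofReal (s ^ (1 - 2 * a) / (1 - 2 * a)) := by
  have hFTC : ∀ {b v : ℝ}, b < 1 → 0 < v →
      ∫⁻ u in Ioo 0 v, ENNReal.ofReal (u ^ (-b)) = ENNReal.ofReal (v ^ (1 - b) / (1 - b)) := by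
    intro b v hb hv
    have hb' : 0 < 1 - b := sub_pos.2 hb
    rw [setLIntegral_Ioo_ofReal_of_hasDerivAt (F := fun u => u ^ (1 - b) / (1 - b)) hv.le]
    · rw [Real.zero_rpow hb'.ne', zero_div, sub_zero]
    · exact ((Real.continuous_rpow_const hb'.le).div_const _).continuousOn
    · intro u hu
      refine (((hasDerivAt_id u).rpow_const (p := 1 - b) (Or.inl hu.1.ne')).div_const
        _).congr_deriv ?_
      rw [show 1 - b - 1 = -b by ring, one_mul, mul_div_cancel_left₀ _ hb'.ne', id]
    · exact fun u hu => Real.rpow_nonneg hu.1.le _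
  have hreflect : ∀ v ∈ Ioc 0 s, ∫⁻ u in Ioo 0 v, 1 * ENNReal.ofReal ((v - u) ^ (-a)) =
      ∫⁻ y in Ioo 0 v, ENNReal.ofReal (y ^ (-a)) := by
    intro v _
    have himage : (fun u : ℝ => v - u) '' Ioo 0 v = Ioo 0 v := by
      rw [image_const_sub_Ioo, sub_self, sub_zero]
    conv_rhs => rw [← himage]
    rw [lintegral_image_eq_lintegral_abs_deriv_mul measurableSet_Ioo
      (fun u _ => ((hasDerivAt_id' u).const_sub v).hasDerivWithinAt) sub_right_injective.injOn]
    simp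
  have h := setLIntegral_mul_lKernel ha hs measurable_const
    (ψ := fun y => ENNReal.ofReal (y ^ (-a))) (by fun_prop) hreflect
  simp only [one_mul] at h
  rw [h, ← hFTC (by linarith) hs]
  refine setLIntegral_congr_fun measurableSet_Ioo fun y hy => ?_
  rw [← ENNReal.ofReal_mul (Real.rpow_nonneg hy.1.le _), ← Real.rpow_add hy.1]
  congr 2
  ring

theorem setLIntegral_rpow_mul_rpow_mul_lKernel {a r s : ℝ} (ha : 0 < a) (ha1 : a < 1)
    (hs : 0 < s) (hsr : s < r) :
    ∫⁻ u in Ioo 0 s, ENNReal.ofReal (u ^ a * (r - u) ^ (-a - 1)) * lKernel a s u =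
      ENNReal.ofReal (ProbabilityTheory.beta (2 * a) (1 - a) * r ^ a *
        ((r - s) ^ (-2 * a) - r ^ (-2 * a))) := by
  have hr := hs.trans hsr
  have hB := ProbabilityTheory.beta_pos (α := 2 * a) (β := 1 - a) (by linarith) (by linarith)
  set B := ProbabilityTheory.beta (2 * a) (1 - a)
  have h := setLIntegral_mul_lKernel (a := a) (s := s) ha hs
    (h := fun u => ENNReal.ofReal (u ^ (2 * a) * (r - u) ^ (-a - 1)))
    (ψ := fun y => ENNReal.ofReal (2 * a * B * r ^ a * y ^ a * (r - y) ^ (-2 * a - 1)))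
    (by fun_prop) (by fun_prop)
    (fun v hv => abelTransform_rpow_mul_rpow ha ha1 hv.1 (hv.2.trans_lt hsr))
  have hleft : ∀ u ∈ Ioo 0 s, ENNReal.ofReal (u ^ a * (r - u) ^ (-a - 1)) * lKernel a s u =
      ENNReal.ofReal (u ^ (2 * a) * (r - u) ^ (-a - 1)) * ENNReal.ofReal (u ^ (-a)) *
        lKernel a s u := by
    intro u hu
    have hru : 0 < r - u := sub_pos.2 (hu.2.trans hsr)
    have hu0 := hu.1
    rw [← ENNReal.ofReal_mul (by positivity), mul_right_comm, ← Real.rpow_add hu0]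
    congr 4
    ring
  have hderiv : ∀ y ∈ Icc 0 s, HasDerivAt (fun y => B * r ^ a * (r - y) ^ (-2 * a))
      (2 * a * B * r ^ a * (r - y) ^ (-2 * a - 1)) y := by
    intro y hy
    have hry : r - y ≠ 0 := (sub_pos.2 (hy.2.trans_lt hsr)).ne'
    refine ((((hasDerivAt_id' y).const_sub r).rpow_const (Or.inl hry)).const_mul
      (B * r ^ a)).congr_deriv ?_
    ring
  rw [setLIntegral_congr_fun measurableSet_Ioo hleft, h, mul_sub,
    show B * r ^ a * r ^ (-2 * a) = B * r ^ a * (r - 0) ^ (-2 * a) by rw [sub_zero],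
    ← setLIntegral_Ioo_ofReal_of_hasDerivAt hs.le
      (fun y hy => (hderiv y hy).continuousAt.continuousWithinAt)
      (fun y hy => hderiv y (Ioo_subset_Icc_self hy))]
  · refine setLIntegral_congr_fun measurableSet_Ioo fun y hy => ?_
    have hy0 := hy.1
    have hya : y ^ (-a) * y ^ a = 1 := by
      rw [← Real.rpow_add hy0, neg_add_cancel, Real.rpow_zero]
    rw [← ENNReal.ofReal_mul (by positivity)]
    congr 1
    linear_combination 2 * a * B * r ^ a * (r - y) ^ (-2 * a - 1) * hya
  · intro y hy
    have hry : 0 < r - y := sub_pos.2 (hy.2.trans hsr)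
    positivity

theorem tendsto_sub_rpow_sub_rpow {p s : ℝ} (hp : 0 ≤ p) (hp1 : p < 1) (hs : 0 < s) :
    Tendsto (fun r : ℝ => (r - s) ^ p - r ^ p) atTop (𝓝 0) := by
  have hlower : Tendsto (fun r : ℝ => -(s * r ^ (-(1 - p)))) atTop (𝓝 0) := by
    simpa using ((tendsto_rpow_neg_atTop (sub_pos.2 hp1)).const_mul s).neg
  refine tendsto_of_tendsto_of_tendsto_of_le_of_le' hlower tendsto_const_nhds ?_ ?_
  · filter_upwards [eventually_gt_atTop s] with r hr
    have hr0 : 0 < r := hs.trans hr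
    have hx : 0 < 1 - s / r := sub_pos.2 ((div_lt_one hr0).2 hr)
    have hx1 : 1 - s / r ≤ 1 := sub_le_self _ (div_pos hs hr0).le
    have h : 1 - s / r ≤ (1 - s / r) ^ p := by
      simpa using Real.rpow_le_rpow_of_exponent_ge hx hx1 hp1.le
    have hsub : r - s = r * (1 - s / r) := by field_simp
    have hpow : r ^ (-(1 - p)) = r ^ p / r := by
      rw [neg_sub, Real.rpow_sub_one hr0.ne']
    rw [hpow, hsub, Real.mul_rpow hr0.le hx.le]
    have := mul_le_mul_of_nonneg_left h (Real.rpow_nonneg hr0.le p)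
    linear_combination this
  · filter_upwards [eventually_gt_atTop s] with r hr
    exact sub_nonpos.2 (Real.rpow_le_rpow (sub_pos.2 hr).le (by linarith) hp)

theorem setLIntegral_Ioi_sub_rpow_sub_rpow {a s t : ℝ} (ha : 0 < a) (ha1 : a < 1 / 2)
    (hs : 0 < s) (hst : s ≤ t) :
    ∫⁻ r in Ioi t, ENNReal.ofReal ((r - s) ^ (-2 * a) - r ^ (-2 * a)) =
      ENNReal.ofReal ((t ^ (1 - 2 * a) - (t - s) ^ (1 - 2 * a)) / (1 - 2 * a)) := by
  have hp : 0 < 1 - 2 * a := by linarith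
  have hlim := (tendsto_sub_rpow_sub_rpow hp.le (by linarith : 1 - 2 * a < 1) hs).div_const
    (1 - 2 * a)
  rw [zero_div] at hlim
  rw [setLIntegral_Ioi_ofReal_of_hasDerivAt ?_ ?_ ?_ hlim]
  · congr 1
    ring
  · have h1 := Real.continuous_rpow_const hp.le
    exact (((h1.comp (continuous_id.sub continuous_const)).sub h1).div_const
      _).continuousWithinAt
  · intro r hr
    have hr' : s < r := hst.trans_lt hr
    refine (((((hasDerivAt_id' r).sub_const s).rpow_const
      (Or.inl (sub_pos.2 hr').ne')).sub ((hasDerivAt_id' r).rpow_const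
      (Or.inl (hs.trans hr').ne'))).div_const _).congr_deriv ?_
    rw [show 1 - 2 * a - 1 = -2 * a by ring]
    field_simp
  · intro r hr
    have hr' : s < r := hst.trans_lt hr
    exact sub_nonneg.2 (Real.rpow_le_rpow_of_nonpos (sub_pos.2 hr') (by linarith) (by linarith))

theorem setLIntegral_lKernel_mul_lKernel {a s t : ℝ} (ha : 0 < a) (ha1 : a < 1 / 2) (hs : 0 < s)
    (hst : s ≤ t) :
    ∫⁻ u in Ioo 0 s, lKernel a t u * lKernel a s u =
      ENNReal.ofReal (a * ProbabilityTheory.beta (2 * a) (1 - a) / (1 - 2 * a) *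
        (t ^ (1 - 2 * a) + s ^ (1 - 2 * a) - (t - s) ^ (1 - 2 * a))) := by
  have hB := ProbabilityTheory.beta_pos (α := 2 * a) (β := 1 - a) (by linarith) (by linarith)
  have ht := hs.trans_le hst
  have hp : 0 < 1 - 2 * a := by linarith
  have hmeas := measurable_lKernel a s
  have hdiff : (t - s) ^ (1 - 2 * a) ≤ t ^ (1 - 2 * a) :=
    Real.rpow_le_rpow (sub_nonneg.2 hst) (by linarith) hp.le
  set B := ProbabilityTheory.beta (2 * a) (1 - a)
  have hsplit : ∀ u ∈ Ioo 0 s, lKernel a t u * lKernel a s u =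
      ENNReal.ofReal (a * B) * (ENNReal.ofReal (u ^ (-a)) * lKernel a s u) +
      ∫⁻ r in Ioi t, ENNReal.ofReal (a * r ^ (-a)) *
        (ENNReal.ofReal (u ^ a * (r - u) ^ (-a - 1)) * lKernel a s u) := by
    intro u hu
    rw [lKernel_eq_add_setLIntegral_Ioi ha (by linarith) hu.1 (hu.2.trans_le hst), add_mul,
      mul_assoc, ← lintegral_mul_const _ (by fun_prop)]
    congr 1
    refine setLIntegral_congr_fun measurableSet_Ioi fun r hr => ?_
    have hr0 : 0 < r := ht.trans hr
    rw [← mul_assoc, ← ENNReal.ofReal_mul (by positivity)]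
    congr 2
    ring
  have hswap : Measurable (Function.uncurry fun u r : ℝ => ENNReal.ofReal (a * r ^ (-a)) *
      (ENNReal.ofReal (u ^ a * (r - u) ^ (-a - 1)) * lKernel a s u)) := by
    simp only [Function.uncurry_def]
    fun_prop
  have hinner : ∀ r ∈ Ioi t, ∫⁻ u in Ioo 0 s, ENNReal.ofReal (a * r ^ (-a)) *
      (ENNReal.ofReal (u ^ a * (r - u) ^ (-a - 1)) * lKernel a s u) =
      ENNReal.ofReal (a * B) * ENNReal.ofReal ((r - s) ^ (-2 * a) - r ^ (-2 * a)) := by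
    intro r hr
    have hr0 : 0 < r := ht.trans hr
    have hra : r ^ (-a) * r ^ a = 1 := by
      rw [← Real.rpow_add hr0, neg_add_cancel, Real.rpow_zero]
    rw [lintegral_const_mul _ (by fun_prop), setLIntegral_rpow_mul_rpow_mul_lKernel ha
      (by linarith) hs (hst.trans_lt hr), ← ENNReal.ofReal_mul (by positivity),
      ← ENNReal.ofReal_mul (by positivity)]
    congr 1
    linear_combination a * B * ((r - s) ^ (-2 * a) - r ^ (-2 * a)) * hra
  rw [setLIntegral_congr_fun measurableSet_Ioo hsplit, lintegral_add_left (by fun_prop),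
    lintegral_const_mul _ (by fun_prop), lintegral_lintegral_swap hswap.aemeasurable,
    setLIntegral_congr_fun measurableSet_Ioi hinner, lintegral_const_mul _ (by fun_prop),
    setLIntegral_rpow_neg_mul_lKernel ha ha1 hs, setLIntegral_Ioi_sub_rpow_sub_rpow ha ha1 hs hst,
    ← mul_add, ← ENNReal.ofReal_add (by positivity) (div_nonneg (sub_nonneg.2 hdiff) hp.le),
    ← ENNReal.ofReal_mul (by positivity)]
  congr 1
  ring

theorem integral_KH_mul_KH {H s t : ℝ} (hH0 : 0 < H) (hH : H < 1 / 2) (hs : 0 < s) (hst : s ≤ t) :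
    ∫ u in Ioo 0 s, KH H t u * KH H s u =
      (1 / 2) * (t ^ (2 * H) + s ^ (2 * H) - (t - s) ^ (2 * H)) := by
  have hB := ProbabilityTheory.beta_pos (α := 1 - 2 * H) (β := H + 1 / 2) (by linarith)
    (by linarith)
  have hc : cH H * cH H =
      2 * H / ((1 - 2 * H) * ProbabilityTheory.beta (1 - 2 * H) (H + 1 / 2)) := by
    rw [cH, betaFn_eq_beta (by linarith) (by linarith)]
    exact Real.mul_self_sqrt (div_nonneg (by linarith) (mul_nonneg (by linarith) hB.le))
  have hcH : 0 ≤ cH H := Real.sqrt_nonneg _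
  have ht := hs.trans_le hst
  have hdiff : (t - s) ^ (2 * H) ≤ t ^ (2 * H) :=
    Real.rpow_le_rpow (sub_nonneg.2 hst) (by linarith) (by linarith)
  have hs2 : 0 < s ^ (2 * H) := Real.rpow_pos_of_pos hs _
  have hnn : ∀ u ∈ Ioo 0 s, 0 ≤ KH H t u * KH H s u := fun u hu =>
    mul_nonneg (KH_nonneg hH hu.1 (hu.2.trans_le hst)) (KH_nonneg hH hu.1 hu.2)
  have hofReal : ∀ u ∈ Ioo 0 s, ENNReal.ofReal (KH H t u * KH H s u) =
      ENNReal.ofReal (cH H * cH H) * (lKernel (1 / 2 - H) t u * lKernel (1 / 2 - H) s u) := by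
    intro u hu
    rw [ENNReal.ofReal_mul (KH_nonneg hH hu.1 (hu.2.trans_le hst)), ENNReal.ofReal_mul hcH,
      ofReal_KH hH0 hH hu.1 (hu.2.trans_le hst), ofReal_KH hH0 hH hu.1 hu.2, mul_mul_mul_comm]
  have hmeas : Measurable fun u => ENNReal.ofReal (cH H * cH H) *
      (lKernel (1 / 2 - H) t u * lKernel (1 / 2 - H) s u) :=
    ((measurable_lKernel _ _).mul (measurable_lKernel _ _)).const_mul _
  rw [integral_eq_lintegral_of_nonneg_ae
    ((ae_restrict_iff' measurableSet_Ioo).2 (ae_of_all _ hnn)),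
    setLIntegral_congr_fun measurableSet_Ioo hofReal,
    lintegral_const_mul' _ _ ENNReal.ofReal_ne_top,
    setLIntegral_lKernel_mul_lKernel (by linarith) (by linarith) hs hst,
    ← ENNReal.ofReal_mul (mul_self_nonneg _), hc, show 2 * (1 / 2 - H) = 1 - 2 * H by ring,
    show 1 - (1 / 2 - H) = H + 1 / 2 by ring, show 1 - (1 - 2 * H) = 2 * H by ring,
    ENNReal.toReal_ofReal]
  · have : 1 - 2 * H ≠ 0 := by linarith
    generalize ProbabilityTheory.beta (1 - 2 * H) (H + 1 / 2) = B at hB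
    field_simp
  · have h1 : 0 < 1 - 2 * H := by linarith
    have h2 : 0 < 1 / 2 - H := by linarith
    have h3 : 0 ≤ t ^ (2 * H) + s ^ (2 * H) - (t - s) ^ (2 * H) := by linarith
    positivity
  · refine AEMeasurable.aestronglyMeasurable (hmeas.ennreal_toReal.aemeasurable.congr ?_)
    refine (ae_restrict_iff' measurableSet_Ioo).2 (ae_of_all _ fun u hu => ?_)
    simp only
    rw [← hofReal u hu, ENNReal.toReal_ofReal (hnn u hu)]

/-- The covariance of fractional Brownian motion with Hurst parameter `H ∈ (0,1/2)`
admits the Volterra representation `R_H(t,s) = ∫₀^{t∧s} K_H(t,u)K_H(s,u) du`. -/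
theorem fbm_covariance_representation (H : ℝ) (hH0 : 0 < H) (hH : H < 1 / 2)
    (t s : ℝ) (ht : 0 < t) (hs : 0 < s) :
    (1 / 2) * (t ^ (2 * H) + s ^ (2 * H) - |t - s| ^ (2 * H)) =
      ∫ u in Ioo 0 (min t s), KH H t u * KH H s u := by
  rcases le_total s t with hst | hts
  · rw [min_eq_right hst, integral_KH_mul_KH hH0 hH hs hst, abs_of_nonneg (sub_nonneg.2 hst)]
  · simp_rw [min_eq_left hts, mul_comm (KH H t _)]
    rw [integral_KH_mul_KH hH0 hH ht hts, abs_sub_comm, abs_of_nonneg (sub_nonneg.2 hts),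
      add_comm (s ^ (2 * H))]
end

section
/- Let b* ∈ L^∞([0,T]×ℝ^d; ℝ^d) and suppose the ODE dX̂(t,x)/dt = b*(t, X̂(t,x)), X̂(0,x) = x admits a continuous flow X̂ : [0,T]×ℝ^d → ℝ^d with a continuous inverse flow Ŷ such that (t,x) ↦ Ŷ(t,x) is in W^{1,∞}_loc with essentially bounded spatial Jacobian. If u is a weak solution in W^{1,p}_loc([0,T]×ℝ^d), p > d, of the transport equation ∂_t u + b*·∇u = 0 with continuous initial datum u_0, then for every x the map t ↦ u(t, X̂(t,x)) is constant, and consequently u(t,x) = u_0(Ŷ(t,x)) for all t and x; in particular the weak solution is unique. -/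
open MeasureTheory Set

section Degree

open Metric Module

variable {E : Type*} [NormedAddCommGroup E] [NormedSpace ℝ E]

theorem LipschitzOnWith.indicator_ball {L : NNReal} {k : ℝ} {h : E → E}
    (hL : LipschitzOnWith L h (closedBall 0 k)) (h0 : ∀ x, ‖x‖ = k → h x = 0) :
    LipschitzWith L ((ball (0 : E) k).indicator h) := by
  have mixed : ∀ x y : E, ‖x‖ < k → k ≤ ‖y‖ → ‖h x‖ ≤ L * dist x y := by
    intro x y hx hy
    have hc : ContinuousOn (fun t : ℝ => ‖AffineMap.lineMap x y t‖) (Icc 0 1) := by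
      refine Continuous.continuousOn ?_
      exact (AffineMap.lineMap_continuous).norm
    obtain ⟨t, ht, hkt⟩ := intermediate_value_Icc zero_le_one hc
      (show k ∈ Icc _ _ by simpa using ⟨hx.le, hy⟩)
    have hkt' : ‖AffineMap.lineMap x y t‖ = k := hkt
    have h1 := hL.dist_le_mul x (by simpa using hx.le) (AffineMap.lineMap x y t)
      (by simpa using hkt'.le)
    rw [h0 _ hkt', dist_zero_right, dist_left_lineMap] at h1
    refine h1.trans (mul_le_mul_of_nonneg_left ?_ L.2)
    calc ‖t‖ * dist x y ≤ 1 * dist x y := by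
          refine mul_le_mul_of_nonneg_right ?_ dist_nonneg
          rw [Real.norm_eq_abs, abs_of_nonneg ht.1]; exact ht.2
      _ = _ := one_mul _
  refine LipschitzWith.of_dist_le_mul fun x y => ?_
  by_cases hx : x ∈ ball (0 : E) k <;> by_cases hy : y ∈ ball (0 : E) k
  · rw [indicator_of_mem hx, indicator_of_mem hy]
    exact hL.dist_le_mul _ (ball_subset_closedBall hx) _ (ball_subset_closedBall hy)
  · rw [indicator_of_mem hx, indicator_of_notMem hy, dist_zero_right]
    exact mixed x y (by simpa using hx) (by simpa using hy)
  · rw [indicator_of_notMem hx, indicator_of_mem hy, dist_zero_left, dist_comm]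
    exact mixed y x (by simpa using hy) (by simpa using hx)
  · rw [indicator_of_notMem hx, indicator_of_notMem hy, dist_self]
    positivity

/-- A contractive perturbation of the identity supported in a ball is a bijection of that ball. -/
theorem bijOn_ball_add_indicator [CompleteSpace E] {c : NNReal} {k : ℝ} {h : E → E}
    (hL : LipschitzWith c ((ball (0 : E) k).indicator h)) (hc : c < 1) :
    BijOn (fun x => x + h x) (ball 0 k) (ball 0 k) := by
  set H := (ball (0 : E) k).indicator h with hH
  set g : E → E := fun x => x + H x with hg
  have happ : ApproximatesLinearOn g ((ContinuousLinearEquiv.refl ℝ E : E ≃L[ℝ] E) : E →L[ℝ] E)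
      univ c := by
    intro x _ y _
    have := hL.dist_le_mul x y
    rw [dist_eq_norm, dist_eq_norm] at this
    have h2 : g x - g y - ((ContinuousLinearEquiv.refl ℝ E : E ≃L[ℝ] E) : E →L[ℝ] E) (x - y)
        = H x - H y := by
      change x + H x - (y + H y) - (x - y) = _
      abel
    rw [h2]
    exact this
  have hsub : Subsingleton E ∨ c < ‖(((ContinuousLinearEquiv.refl ℝ E).symm : E ≃L[ℝ] E) :
      E →L[ℝ] E)‖₊⁻¹ := by
    rcases subsingleton_or_nontrivial E with h | h
    · exact Or.inl h
    · right
      have : ‖(((ContinuousLinearEquiv.refl ℝ E).symm : E ≃L[ℝ] E) : E →L[ℝ] E)‖₊ = 1 := by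
        ext; exact ContinuousLinearMap.norm_id
      rw [this]; simpa using hc
  have hinj : Function.Injective g := by
    have := happ.injOn hsub
    exact injOn_univ.1 this
  have hsurj : Function.Surjective g := happ.surjective hsub
  have hout : ∀ x, x ∉ ball (0 : E) k → g x = x := fun x hx => by
    simp [hg, hH, indicator_of_notMem hx]
  have hin : EqOn g (fun x => x + h x) (ball 0 k) := fun x hx => by
    simp only [hg, hH, indicator_of_mem hx]
  refine BijOn.congr ⟨?_, hinj.injOn, ?_⟩ hin
  · intro x hx
    by_contra hgx
    have := hinj (hout _ hgx)
    rw [this] at hgx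
    exact hgx hx
  · intro y hy
    obtain ⟨x, rfl⟩ := hsurj y
    refine ⟨x, ?_, rfl⟩
    by_contra hx
    rw [hout x hx] at hy
    exact hx hy

variable [FiniteDimensional ℝ E]

theorem LinearMap.exists_polynomial_det_id_add_smul (A : E →ₗ[ℝ] E) :
    ∃ q : Polynomial ℝ, q.natDegree ≤ finrank ℝ E ∧
      ∀ s : ℝ, q.eval s = LinearMap.det (LinearMap.id + s • A) := by
  classical
  let b := finBasis ℝ E
  let N := LinearMap.toMatrix b b A
  refine ⟨((Polynomial.X : Polynomial ℝ) • N.map Polynomial.C +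
    (1 : Matrix _ _ ℝ).map Polynomial.C).det, ?_, fun s => ?_⟩
  · simpa using Polynomial.natDegree_det_X_add_C_le N 1
  · rw [← LinearMap.det_toMatrix b, map_add, map_smul, LinearMap.toMatrix_id,
      ← Polynomial.coe_evalRingHom, RingHom.map_det]
    congr 1
    ext i j
    simp only [Polynomial.coe_evalRingHom, RingHom.mapMatrix_apply, Matrix.map_apply, Matrix.add_apply,
      Matrix.smul_apply, smul_eq_mul, Matrix.one_apply, Polynomial.eval_add, Polynomial.eval_mul,
      Polynomial.eval_X, Polynomial.eval_C, N]
    ring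

variable [MeasurableSpace E] [BorelSpace E]

theorem integral_ball_det_eq_of_small (μ : Measure E) [μ.IsAddHaarMeasure] {k : ℝ} {h : E → E}
    (hh : ContDiff ℝ 1 h) (h0 : ∀ x, ‖x‖ = k → h x = 0) :
    ∃ δ > 0, ∀ s ∈ Ioo (0 : ℝ) δ,
      ∫ x in ball 0 k, (ContinuousLinearMap.id ℝ E + s • fderiv ℝ h x).det ∂μ
        = μ.real (ball 0 k) := by
  have hK : IsCompact (closedBall (0 : E) k) := isCompact_closedBall 0 k
  have hdc : Continuous (fderiv ℝ h) := hh.continuous_fderiv one_ne_zero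
  have hdiff : Differentiable ℝ h := hh.differentiable one_ne_zero
  obtain ⟨C, hC⟩ := hK.exists_bound_of_continuousOn hdc.continuousOn
  set L : NNReal := ⟨max C 0, le_max_right _ _⟩ with hLdef
  have hL : LipschitzOnWith L h (closedBall 0 k) := by
    refine (convex_closedBall (0 : E) k).lipschitzOnWith_of_nnnorm_fderiv_le (𝕜 := ℝ)
      (fun x _ => hdiff x) fun x hx => ?_
    exact (hC x hx).trans (le_max_left _ _)
  have hLi := hL.indicator_ball h0
  have hcont : Continuous fun p : ℝ × E =>
      (ContinuousLinearMap.id ℝ E + p.1 • fderiv ℝ h p.2).det :=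
    ContinuousLinearMap.continuous_det.comp
      (continuous_const.add (continuous_fst.smul (hdc.comp continuous_snd)))
  have hpos : ∀ᶠ s in nhds (0 : ℝ), ∀ x ∈ closedBall (0 : E) k,
      0 < (ContinuousLinearMap.id ℝ E + s • fderiv ℝ h x).det := by
    refine hK.eventually_forall_of_forall_eventually fun y _ => ?_
    refine hcont.continuousAt.eventually (lt_mem_nhds ?_)
    simp [ContinuousLinearMap.det]
  obtain ⟨δ₁, hδ₁, hδ₁pos⟩ := Metric.eventually_nhds_iff.1 hpos
  refine ⟨min δ₁ (1 / (L + 1)), lt_min hδ₁ (by positivity), fun s hs => ?_⟩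
  have hs1 : s < δ₁ := hs.2.trans_le (min_le_left _ _)
  have hs2 : s < 1 / (L + 1) := hs.2.trans_le (min_le_right _ _)
  have hbij : BijOn (fun x => x + s • h x) (ball (0 : E) k) (ball 0 k) := by
    refine bijOn_ball_add_indicator (c := ‖s‖₊ * L) (h := fun x => s • h x) ?_ ?_
    · have : (ball (0 : E) k).indicator (fun x => s • h x)
          = fun x => s • (ball (0 : E) k).indicator h x := by
        ext x; by_cases hx : x ∈ ball (0 : E) k <;> simp [hx]
      rw [this]
      exact (lipschitzWith_smul s).comp hLi
    · rw [← NNReal.coe_lt_coe]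
      push_cast
      rw [Real.norm_eq_abs, abs_of_pos hs.1]
      rw [lt_div_iff₀ (by positivity)] at hs2
      nlinarith [hs.1]
  have hder : ∀ x ∈ ball (0 : E) k, HasFDerivWithinAt (fun x => x + s • h x)
      (ContinuousLinearMap.id ℝ E + s • fderiv ℝ h x) (ball 0 k) x := fun x _ =>
    ((hasFDerivAt_id x).add ((hdiff x).hasFDerivAt.const_smul s)).hasFDerivWithinAt
  have key := integral_image_eq_integral_abs_det_fderiv_smul μ measurableSet_ball hder
    hbij.injOn (fun _ => (1 : ℝ))
  rw [hbij.image_eq] at key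
  simp only [integral_const, smul_eq_mul, mul_one, measureReal_restrict_apply_univ] at key
  rw [key]
  refine setIntegral_congr_fun measurableSet_ball fun x hx => ?_
  have := hδ₁pos (y := s) (by simpa [abs_of_pos hs.1] using hs1) x (ball_subset_closedBall hx)
  exact (abs_of_pos this).symm

theorem integral_ball_det_eq (μ : Measure E) [μ.IsAddHaarMeasure] {k : ℝ} {h : E → E}
    (hh : ContDiff ℝ 1 h) (h0 : ∀ x, ‖x‖ = k → h x = 0) :
    ∫ x in ball 0 k, (ContinuousLinearMap.id ℝ E + fderiv ℝ h x).det ∂μ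
        = μ.real (ball 0 k) := by
  classical
  obtain ⟨δ, hδ, hsmall⟩ := integral_ball_det_eq_of_small μ hh h0
  have hdc : Continuous (fderiv ℝ h) := hh.continuous_fderiv one_ne_zero
  set n := finrank ℝ E
  let S := Finset.range (n + 1)
  let v : ℕ → ℝ := fun i => δ / (i + 2)
  have hvinj : InjOn v S := by
    intro i _ j _ hij
    have h1 : δ / ((i : ℝ) + 2) = δ / (j + 2) := hij
    rw [div_eq_div_iff (by positivity) (by positivity)] at h1
    have := mul_left_cancel₀ hδ.ne' h1
    exact_mod_cast (add_right_cancel this).symm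
  have hvmem : ∀ i, v i ∈ Ioo 0 δ := fun i =>
    ⟨by positivity, div_lt_self hδ (by have : (0 : ℝ) ≤ i := i.cast_nonneg; linarith)⟩
  have hinterp : ∀ A : E →L[ℝ] E, (ContinuousLinearMap.id ℝ E + A).det =
      ∑ i ∈ S, (ContinuousLinearMap.id ℝ E + v i • A).det *
        (Lagrange.basis S v i).eval 1 := by
    intro A
    obtain ⟨q, hqd, hq⟩ := LinearMap.exists_polynomial_det_id_add_smul (A : E →ₗ[ℝ] E)
    have hdeg : q.degree < S.card := by
      rw [Finset.card_range]
      refine (Polynomial.degree_le_natDegree).trans_lt ?_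
      exact_mod_cast Nat.lt_succ_of_le hqd
    have h1 := congrArg (Polynomial.eval 1) (Lagrange.eq_interpolate hvinj hdeg)
    rw [Lagrange.interpolate_apply, Polynomial.eval_finsetSum] at h1
    simp only [Polynomial.eval_mul, Polynomial.eval_C, hq, one_smul] at h1
    exact h1
  have hsum : ∑ i ∈ S, (Lagrange.basis S v i).eval 1 = 1 := by
    rw [← Polynomial.eval_finsetSum, Lagrange.sum_basis hvinj ⟨0, by simp [S]⟩,
      Polynomial.eval_one]
  have hint : ∀ s : ℝ, IntegrableOn
      (fun x => (ContinuousLinearMap.id ℝ E + s • fderiv ℝ h x).det) (ball 0 k) μ := by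
    intro s
    have hc : Continuous fun x => (ContinuousLinearMap.id ℝ E + s • fderiv ℝ h x).det :=
      ContinuousLinearMap.continuous_det.comp (continuous_const.add (hdc.const_smul s))
    exact (hc.continuousOn.integrableOn_compact (isCompact_closedBall (0 : E) k)).mono_set
      ball_subset_closedBall
  rw [integral_congr_ae (Filter.Eventually.of_forall fun x => hinterp (fderiv ℝ h x))]
  rw [integral_finsetSum _ fun i _ => (hint (v i)).mul_const _]
  simp_rw [integral_mul_const]
  rw [Finset.sum_congr rfl fun i _ => by rw [hsmall (v i) (hvmem i)], ← Finset.mul_sum, hsum,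
    mul_one]

end Degree

section Surjective

open Metric Module

variable {E : Type*} [NormedAddCommGroup E] [InnerProductSpace ℝ E] [FiniteDimensional ℝ E]

/-- There is no `C¹` retraction of a ball onto its boundary sphere. -/
theorem not_exists_retraction_sphere {k : ℝ} (hk : 0 < k) {r : E → E} (hr : ContDiff ℝ 1 r)
    (hnorm : ∀ x, ‖r x‖ = k) (hid : ∀ x, ‖x‖ = k → r x = x) : False := by
  borelize E
  let μ : Measure E := Measure.addHaar
  have key := integral_ball_det_eq μ (h := fun x => r x - x) (k := k) (hr.sub contDiff_id)
    (fun x hx => by rw [hid x hx, sub_self])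
  have hdiff : Differentiable ℝ r := hr.differentiable one_ne_zero
  have hdet : ∀ x, (ContinuousLinearMap.id ℝ E + fderiv ℝ (fun x => r x - x) x).det = 0 := by
    intro x
    have h1 : ContinuousLinearMap.id ℝ E + fderiv ℝ (fun x => r x - x) x = fderiv ℝ r x := by
      rw [fderiv_fun_sub (hdiff x) differentiableAt_fun_id, fderiv_fun_id]
      abel
    rw [h1]
    have horth : ∀ w, inner ℝ (r x) (fderiv ℝ r x w) = 0 := by
      intro w
      have h2 := ((hdiff x).hasFDerivAt.inner ℝ (hdiff x).hasFDerivAt)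
      have h3 : (fun t => inner ℝ (r t) (r t)) = fun _ => k ^ 2 := by
        ext t; rw [real_inner_self_eq_norm_sq, hnorm]
      rw [h3] at h2
      have h4 := congrArg (fun A => A w) (h2.unique (hasFDerivAt_const _ x))
      simp [real_inner_comm] at h4
      exact h4
    by_contra hne
    have hsurj : Function.Surjective (fderiv ℝ r x) := by
      have : IsUnit (LinearMap.det (fderiv ℝ r x : E →ₗ[ℝ] E)) := isUnit_iff_ne_zero.2 hne
      exact ((LinearMap.isUnit_iff_isUnit_det _).2 this |> (Module.End.isUnit_iff _).1).2
    obtain ⟨w, hw⟩ := hsurj (r x)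
    have := horth w
    rw [hw, real_inner_self_eq_norm_sq, hnorm] at this
    exact (pow_pos hk 2).ne' this
  simp only [hdet, integral_zero] at key
  exact (ENNReal.toReal_pos (measure_ball_pos μ 0 hk).ne' measure_ball_lt_top.ne).ne key

theorem exists_eq_zero_of_norm_sub_id_le {R : ℝ} {f : E → E} (hf : Continuous f)
    (hR : ∀ x, ‖f x - x‖ ≤ R) : ∃ x, f x = 0 := by
  by_contra! hne
  have hR0 : 0 ≤ R := (norm_nonneg _).trans (hR 0)
  obtain ⟨h, hh, happ, -⟩ := (hf.sub continuous_id).exists_contDiff_approx 1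
    (ε := fun x => min 1 ‖f x‖) (continuous_const.min hf.norm)
    (fun x => lt_min one_pos (norm_pos_iff.2 (hne x)))
  let χ : ContDiffBump (0 : E) := ⟨R + 2, R + 3, by linarith, by linarith⟩
  let F : E → E := fun x => x + χ x • h x
  have hhb : ∀ x, ‖h x‖ ≤ R + 1 := fun x => by
    have h1 := (happ x).trans_le (min_le_left _ _)
    rw [dist_eq_norm] at h1
    calc ‖h x‖ = ‖(h x - (f x - x)) + (f x - x)‖ := by congr 1; abel
      _ ≤ _ := norm_add_le _ _
      _ ≤ 1 + R := add_le_add h1.le (hR x)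
      _ = _ := add_comm _ _
  have hFne : ∀ x, F x ≠ 0 := by
    intro x hx
    by_cases hxR : ‖x‖ ≤ R + 2
    · have hχ : χ x = 1 := χ.one_of_mem_closedBall (by simpa [χ] using hxR)
      have h1 := (happ x).trans_le (min_le_right _ _)
      simp only [F, hχ, one_smul] at hx
      rw [dist_eq_norm] at h1
      have : h x - (f x - x) = - f x := by
        rw [← sub_eq_zero, ← hx]; abel
      simp only [Pi.sub_apply, id, this, norm_neg, lt_irrefl] at h1
    · have h2 : ‖χ x • h x‖ ≤ R + 1 := by
        rw [norm_smul, Real.norm_eq_abs, abs_of_nonneg χ.nonneg]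
        calc χ x * ‖h x‖ ≤ 1 * ‖h x‖ := mul_le_mul_of_nonneg_right χ.le_one (norm_nonneg _)
          _ ≤ _ := by rw [one_mul]; exact hhb x
      have : x = -(χ x • h x) := eq_neg_of_add_eq_zero_left hx
      rw [← norm_neg, ← this] at h2
      linarith
  have hFc : ContDiff ℝ 1 F := contDiff_id.add (χ.contDiff.smul hh)
  have hFid : ∀ x, ‖x‖ = R + 3 → F x = x := fun x hx => by
    have : χ x = 0 := χ.zero_of_le_dist (by simp [χ, hx])
    simp [F, this]
  refine not_exists_retraction_sphere (k := R + 3) (by linarith)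
    (r := fun x => ((R + 3) * ‖F x‖⁻¹) • F x) ?_ ?_ ?_
  · exact (contDiff_const.mul ((hFc.norm ℝ hFne).inv fun x => (norm_pos_iff.2 (hFne x)).ne')).smul
      hFc
  · intro x
    have := (norm_pos_iff.2 (hFne x)).ne'
    rw [norm_smul, norm_mul, norm_inv, norm_norm, Real.norm_eq_abs, abs_of_nonneg (by linarith)]
    field_simp
  · intro x hx
    simp only [hFid x hx, hx]
    rw [mul_inv_cancel₀ (by linarith), one_smul]

end Surjective

theorem surjective_of_dist_id_le {d : ℕ} {R : ℝ} {f : (Fin d → ℝ) → (Fin d → ℝ)}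
    (hf : Continuous f) (hR : ∀ x, ‖f x - x‖ ≤ R) : Function.Surjective f := by
  intro y
  let e := EuclideanSpace.equiv (Fin d) ℝ
  let F : EuclideanSpace ℝ (Fin d) → EuclideanSpace ℝ (Fin d) :=
    fun x => e.symm (f (e x + y) - y)
  have hF : Continuous F :=
    e.symm.continuous.comp ((hf.comp (e.continuous.add continuous_const)).sub continuous_const)
  obtain ⟨x, hx⟩ := exists_eq_zero_of_norm_sub_id_le hF
    (R := ‖(e.symm : (Fin d → ℝ) →L[ℝ] EuclideanSpace ℝ (Fin d))‖ * R) fun x => by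
      have : F x - x = (e.symm : (Fin d → ℝ) →L[ℝ] EuclideanSpace ℝ (Fin d))
          (f (e x + y) - (e x + y)) := by
        simp only [F, ContinuousLinearEquiv.coe_coe, map_sub, map_add,
          ContinuousLinearEquiv.symm_apply_apply]
        abel
      rw [this]
      exact (ContinuousLinearMap.le_opNorm _ _).trans
        (mul_le_mul_of_nonneg_left (hR _) (norm_nonneg _))
  refine ⟨e x + y, ?_⟩
  have : f (e x + y) - y = 0 := e.symm.map_eq_zero_iff.1 hx
  exact sub_eq_zero.1 this

section Mollification

variable {E : Type*} [NormedAddCommGroup E] [NormedSpace ℝ E] [FiniteDimensional ℝ E]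
  [MeasurableSpace E] [BorelSpace E] (μ : Measure E) [μ.IsAddHaarMeasure]

theorem MeasureTheory.Integrable.exists_lintegral_translate_sub_le {f : E → ℝ}
    (hf : Integrable f μ) {δ : ENNReal} (hδ : 0 < δ) :
    ∃ ε > 0, ∀ w : E, ‖w‖ < ε → ∫⁻ z, ‖f (z - w) - f z‖ₑ ∂μ ≤ δ := by
  have hf1 : MemLp f 1 μ := memLp_one_iff_integrable.2 hf
  let g : C(E, C(E, E)) :=
    (ContinuousMap.mk (fun p : E × E => p.2 - p.1) (continuous_snd.sub continuous_fst)).curry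
  have hg : ∀ w, MeasurePreserving (g w) μ μ := fun w => measurePreserving_sub_right μ w
  have hc : Continuous fun w => Lp.compMeasurePreserving (g w) (hg w) (hf1.toLp f) :=
    (continuous_const (y := hf1.toLp f)).compMeasurePreservingLp g.continuous hg ENNReal.one_ne_top
  have h0 := hc.tendsto 0
  have h1 := (EMetric.tendsto_nhds.1 h0) δ hδ
  obtain ⟨ε, hε, hball⟩ := Metric.eventually_nhds_iff.1 h1
  refine ⟨ε, hε, fun w hw => ?_⟩
  have h2 := hball (y := w) (by simpa using hw)
  rw [Lp.toLp_compMeasurePreserving, Lp.toLp_compMeasurePreserving, Lp.edist_toLp_toLp,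
    eLpNorm_one_eq_lintegral_enorm] at h2
  refine le_trans (le_of_eq ?_) h2.le
  refine lintegral_congr fun z => ?_
  simp [g]

theorem lintegral_mollify_sub_le {f φ : E → ℝ} (hf : Integrable f μ) {δ : ENNReal} {ε : ℝ}
    (hδ : ∀ w : E, ‖w‖ < ε → ∫⁻ z, ‖f (z - w) - f z‖ₑ ∂μ ≤ δ)
    (hφc : Continuous φ) (hφs : HasCompactSupport φ) (hφ0 : ∀ w, 0 ≤ φ w)
    (hφε : Function.support φ ⊆ Metric.ball 0 ε) (hφ1 : ∫ w, φ w ∂μ = 1) :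
    ∫⁻ z, ‖(∫ w, φ (z - w) * f w ∂μ) - f z‖ₑ ∂μ ≤ δ := by
  have hφi : Integrable φ μ := hφc.integrable_of_hasCompactSupport hφs
  obtain ⟨C, hC⟩ := hφc.bounded_above_of_compact_support hφs
  have hstep : ∀ z, ‖(∫ w, φ (z - w) * f w ∂μ) - f z‖ₑ
      ≤ ∫⁻ w, ‖φ w‖ₑ * ‖f (z - w) - f z‖ₑ ∂μ := by
    intro z
    have h1 : ∫ w, φ (z - w) * f w ∂μ = ∫ w, φ w * f (z - w) ∂μ := by
      rw [← integral_sub_left_eq_self _ μ z]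
      simp
    have h2 : Integrable (fun w => φ w * f (z - w)) μ :=
      (hf.comp_sub_left z).bdd_mul hφc.aestronglyMeasurable (Filter.Eventually.of_forall hC)
    have h3 : (∫ w, φ (z - w) * f w ∂μ) - f z = ∫ w, φ w * (f (z - w) - f z) ∂μ := by
      simp_rw [mul_sub]
      rw [integral_sub h2 (hφi.mul_const _), integral_mul_const, hφ1, one_mul, h1]
    rw [h3]
    refine (enorm_integral_le_lintegral_enorm _).trans (le_of_eq ?_)
    simp_rw [enorm_mul]
  have hmeas : AEMeasurable (Function.uncurry fun z w => ‖φ w‖ₑ * ‖f (z - w) - f z‖ₑ)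
      (μ.prod μ) := by
    have h1 : AEStronglyMeasurable (fun p : E × E => f (p.1 - p.2)) (μ.prod μ) :=
      hf.aestronglyMeasurable.comp_quasiMeasurePreserving
        (quasiMeasurePreserving_sub_of_right_invariant μ μ)
    have h2 : AEStronglyMeasurable (fun p : E × E => f p.1) (μ.prod μ) :=
      hf.aestronglyMeasurable.comp_fst
    exact ((hφc.comp continuous_snd).enorm.measurable.aemeasurable).mul (h1.sub h2).enorm
  calc ∫⁻ z, ‖(∫ w, φ (z - w) * f w ∂μ) - f z‖ₑ ∂μ
      ≤ ∫⁻ z, ∫⁻ w, ‖φ w‖ₑ * ‖f (z - w) - f z‖ₑ ∂μ ∂μ := lintegral_mono hstep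
    _ = ∫⁻ w, ∫⁻ z, ‖φ w‖ₑ * ‖f (z - w) - f z‖ₑ ∂μ ∂μ := lintegral_lintegral_swap hmeas
    _ = ∫⁻ w, ‖φ w‖ₑ * ∫⁻ z, ‖f (z - w) - f z‖ₑ ∂μ ∂μ := by
        refine lintegral_congr fun w => lintegral_const_mul' _ _ enorm_ne_top
    _ ≤ ∫⁻ w, ‖φ w‖ₑ * δ ∂μ := by
        refine lintegral_mono fun w => ?_
        by_cases hw : φ w = 0
        · simp [hw]
        · gcongr
          exact hδ w (by simpa using hφε hw)
    _ = δ := by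
        rw [lintegral_mul_const _ hφc.enorm.measurable]
        have : ∫⁻ w, ‖φ w‖ₑ ∂μ = 1 := by
          simp_rw [Real.enorm_of_nonneg (hφ0 _)]
          rw [← ofReal_integral_eq_lintegral_ofReal hφi (Filter.Eventually.of_forall hφ0), hφ1,
            ENNReal.ofReal_one]
        rw [this, one_mul]

theorem exists_smooth_mollifier {ε : ℝ} (hε : 0 < ε) :
    ∃ φ : E → ℝ, ContDiff ℝ (⊤ : ℕ∞) φ ∧ HasCompactSupport φ ∧ (∀ x, 0 ≤ φ x) ∧
      Function.support φ ⊆ Metric.ball 0 ε ∧ ∫ x, φ x ∂μ = 1 := by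
  let χ : ContDiffBump (0 : E) := ⟨ε / 2, ε, by linarith, by linarith⟩
  exact ⟨χ.normed μ, χ.contDiff_normed, χ.hasCompactSupport_normed, χ.nonneg_normed,
    χ.support_normed_eq.subset, χ.integral_normed⟩

theorem hasFDerivAt_mollify {φ u : E → ℝ} (hφ : ContDiff ℝ 1 φ) (hφs : HasCompactSupport φ)
    (hu : Continuous u) (z : E) :
    ∃ A : E →L[ℝ] ℝ, HasFDerivAt (fun z => ∫ w, φ (z - w) * u w ∂μ) A z ∧
      ∀ v, A v = ∫ w, fderiv ℝ φ (z - w) v * u w ∂μ := by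
  have h1 := hφs.hasFDerivAt_convolution_left (ContinuousLinearMap.mul ℝ ℝ) hφ
    (hu.locallyIntegrable (μ := μ)) z
  have h2 : convolution φ u (ContinuousLinearMap.mul ℝ ℝ) μ
      = fun z => ∫ w, φ (z - w) * u w ∂μ := by
    ext x
    rw [convolution_eq_swap]
    rfl
  rw [h2] at h1
  refine ⟨_, h1, fun v => ?_⟩
  rw [convolution_eq_swap, ContinuousLinearMap.integral_apply]
  · rfl
  · have hc : Continuous (fderiv ℝ φ) := hφ.continuous_fderiv one_ne_zero
    have hs : HasCompactSupport (fderiv ℝ φ) := hφs.fderiv ℝ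
    have hs' : HasCompactSupport (fun w => fderiv ℝ φ (z - w)) :=
      hs.comp_homeomorph (Homeomorph.subLeft z)
    refine Continuous.integrable_of_hasCompactSupport ?_ ?_
    · exact ((ContinuousLinearMap.precompL E (ContinuousLinearMap.mul ℝ ℝ)).continuous.comp
        (hc.comp (continuous_const.sub continuous_id))).clm_apply hu
    · refine hs'.mono fun w hw => ?_
      simp only [Function.mem_support] at hw ⊢
      contrapose! hw
      rw [hw, map_zero, zero_apply]

theorem contDiff_mollify {φ u : E → ℝ} (hφ : ContDiff ℝ 1 φ) (hφs : HasCompactSupport φ)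
    (hu : Continuous u) : ContDiff ℝ 1 (fun z => ∫ w, φ (z - w) * u w ∂μ) := by
  have h2 : convolution φ u (ContinuousLinearMap.mul ℝ ℝ) μ
      = fun z => ∫ w, φ (z - w) * u w ∂μ := by
    ext x
    rw [convolution_eq_swap]
    rfl
  rw [← h2]
  exact hφs.contDiff_convolution_left (n := 1) _ hφ hu.locallyIntegrable

theorem dist_mollify_le {φ u : E → ℝ} {ε δ : ℝ} (hδ : 0 ≤ δ) (hφ0 : ∀ w, 0 ≤ φ w)
    (hφε : Function.support φ ⊆ Metric.ball 0 ε) (hφ1 : ∫ w, φ w ∂μ = 1)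
    (hu : Continuous u) {z : E} (hz : ∀ w ∈ Metric.ball z ε, dist (u w) (u z) ≤ δ) :
    dist (∫ w, φ (z - w) * u w ∂μ) (u z) ≤ δ := by
  have h := dist_convolution_le (μ := μ) hδ hφε hφ0 hφ1 hu.aestronglyMeasurable hz
  rw [convolution_eq_swap] at h
  exact h

end Mollification

theorem sub_eq_integral_fderiv_of_integral_curve {E : Type*} [NormedAddCommGroup E]
    [NormedSpace ℝ E] [FiniteDimensional ℝ E] {U : ℝ × E → ℝ} (hU : ContDiff ℝ 1 U)
    {a : ℝ → E} (ha : AEStronglyMeasurable a volume) {M : ℝ} (haM : ∀ t, ‖a t‖ ≤ M) {x : E}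
    {X : ℝ → E} {T : ℝ} (hX : ∀ t ∈ Icc 0 T, X t = x + ∫ s in Ioc 0 t, a s)
    {t₁ t₂ : ℝ} (h1 : 0 ≤ t₁) (h12 : t₁ ≤ t₂) (h2 : t₂ ≤ T) :
    U (t₂, X t₂) - U (t₁, X t₁) = ∫ s in t₁..t₂, fderiv ℝ U (s, X s) (1, a s) := by
  have hM : 0 ≤ M := (norm_nonneg _).trans (haM 0)
  have hint : ∀ c d : ℝ, IntervalIntegrable a volume c d := fun c d =>
    (intervalIntegrable_const (c := M)).mono_fun ha.restrict
      (Filter.Eventually.of_forall fun t => (haM t).trans (Real.le_norm_self M))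
  set Y : ℝ → E := fun t => x + ∫ s in (0 : ℝ)..t, a s with hY
  have hXY : ∀ t ∈ Icc 0 T, X t = Y t := fun t ht => by
    simp only [hY]
    rw [hX t ht, intervalIntegral.integral_of_le ht.1]
  have hYlip : LipschitzWith (max 1 (Real.toNNReal M)) (fun t => (t, Y t)) := by
    refine LipschitzWith.id.prodMk (LipschitzWith.of_dist_le_mul fun s t => ?_)
    rw [dist_eq_norm, hY, add_sub_add_left_eq_sub,
      intervalIntegral.integral_interval_sub_left (hint _ _) (hint _ _), Real.coe_toNNReal _ hM,
      Real.dist_eq]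
    exact intervalIntegral.norm_integral_le_of_norm_le_const fun t _ => haM t
  have hlip : ∃ K, LipschitzOnWith K (fun t => U (t, Y t)) (uIcc t₁ t₂) := by
    have hc : IsCompact ((fun t => (t, Y t)) '' (uIcc t₁ t₂)) :=
      isCompact_uIcc.image hYlip.continuous
    obtain ⟨r, hr⟩ := hc.isBounded.subset_closedBall 0
    obtain ⟨C, hC⟩ := (isCompact_closedBall (0 : ℝ × E) r).exists_bound_of_continuousOn
      (hU.continuous_fderiv one_ne_zero).continuousOn
    have hUl : LipschitzOnWith (Real.toNNReal C) U (Metric.closedBall 0 r) := by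
      refine (convex_closedBall _ _).lipschitzOnWith_of_nnnorm_fderiv_le (𝕜 := ℝ)
        (fun y _ => hU.differentiable one_ne_zero y) fun y hy => ?_
      rw [← NNReal.coe_le_coe]
      exact (hC y hy).trans (Real.le_coe_toNNReal C)
    exact ⟨_, hUl.comp hYlip.lipschitzOnWith fun t ht => hr (mem_image_of_mem _ ht)⟩
  obtain ⟨K, hK⟩ := hlip
  have hftc := hK.absolutelyContinuousOnInterval.integral_deriv_eq_sub
  rw [hXY t₂ ⟨h1.trans h12, h2⟩, hXY t₁ ⟨h1, h12.trans h2⟩, ← hftc]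
  refine intervalIntegral.integral_congr_ae ?_
  filter_upwards [(hint 0 t₂).ae_hasDerivAt_integral] with s hs hsm
  rw [uIoc_of_le h12] at hsm
  have hs0 : 0 ≤ s := h1.trans hsm.1.le
  have hd := hs (by rw [uIcc_of_le (h1.trans h12)]; exact ⟨hs0, hsm.2⟩) 0 left_mem_uIcc
  have hd' : HasDerivAt (fun t => (t, Y t)) (1, a s) s := (hasDerivAt_id s).prodMk (hd.const_add x)
  have := ((hU.differentiable one_ne_zero (s, Y s)).hasFDerivAt.comp_hasDerivAt s hd').deriv
  rw [hXY s ⟨hs0, hsm.2.trans h2⟩]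
  exact this

theorem map_restrict_le_of_lipschitzOnWith_leftInverse {d : ℕ} {f g : (Fin d → ℝ) → (Fin d → ℝ)}
    {B K : Set (Fin d → ℝ)} {L : NNReal} (hf : Measurable f) (hgf : ∀ x, g (f x) = x)
    (hg : LipschitzOnWith L g K) (hBK : MapsTo f B K) :
    (volume.restrict B).map f ≤ (L ^ d : ENNReal) • (volume : Measure (Fin d → ℝ)).restrict K := by
  refine Measure.le_iff.2 fun A hA => ?_
  rw [Measure.map_apply hf hA, Measure.restrict_apply (hf hA), Measure.smul_apply,
    Measure.restrict_apply hA, smul_eq_mul]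
  have hsub : f ⁻¹' A ∩ B ⊆ g '' (A ∩ K) := fun x hx => ⟨f x, ⟨hx.1, hBK hx.2⟩, hgf x⟩
  refine (measure_mono hsub).trans ?_
  have h := (hg.mono (inter_subset_right (s := A))).hausdorffMeasure_image_le (d := d)
    (Nat.cast_nonneg d)
  have hvol : (Measure.hausdorffMeasure (d : ℝ) : Measure (Fin d → ℝ)) = volume := by
    simpa using hausdorffMeasure_pi_real (ι := Fin d)
  rw [hvol, ENNReal.rpow_natCast] at h
  exact h

/-- If the mollifications of `u` have time derivative `-β` and spatial derivatives `G i` up to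
mollification, where `β = ∑ i, b i * G i`, and the flow `X` of `b` has compression bounded by `c`,
then `u` is constant along almost every trajectory. -/
theorem lintegral_sub_along_flow_eq_zero {d : ℕ} {T M r t₁ t₂ : ℝ}
    (h1 : 0 ≤ t₁) (h12 : t₁ ≤ t₂) (h2 : t₂ ≤ T)
    {b : ℝ → (Fin d → ℝ) → (Fin d → ℝ)} (hbm : Measurable (Function.uncurry b))
    (hbb : ∀ t x, ‖b t x‖ ≤ M) {X : ℝ → (Fin d → ℝ) → (Fin d → ℝ)}
    (hXc : Continuous fun q : ℝ × (Fin d → ℝ) => X q.1 q.2)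
    (hflow : ∀ x, ∀ t ∈ Icc (0 : ℝ) T, X t x = x + ∫ s in Ioc 0 t, b s (X s x))
    {B : Set (Fin d → ℝ)} (hB : volume B ≠ ⊤) {c : ENNReal} (hc : c ≠ ⊤)
    (hBr : ∀ t ∈ Icc t₁ t₂, MapsTo (X t) B (Metric.closedBall 0 r))
    (hBm : MeasurableSet B)
    (hmap : ∀ t ∈ Icc t₁ t₂, (volume.restrict B).map (X t) ≤
      c • (volume : Measure (Fin d → ℝ)).restrict (Metric.closedBall 0 r))
    {u : ℝ → (Fin d → ℝ) → ℝ} (huc : Continuous fun q : ℝ × (Fin d → ℝ) => u q.1 q.2)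
    {G : Fin d → ℝ × (Fin d → ℝ) → ℝ} {β : ℝ × (Fin d → ℝ) → ℝ}
    (hG : ∀ i, Integrable (G i)) (hβ : Integrable β)
    (hβG : ∀ z, β z = ∑ i, b z.1 z.2 i * G i z)
    (hmol : ∀ᶠ ε in nhdsWithin (0 : ℝ) (Ioi 0), ∃ φ : ℝ × (Fin d → ℝ) → ℝ,
      ContDiff ℝ 1 φ ∧ HasCompactSupport φ ∧ (∀ w, 0 ≤ φ w) ∧
      Function.support φ ⊆ Metric.ball 0 ε ∧ ∫ w, φ w = 1 ∧
      ∀ z ∈ Icc t₁ t₂ ×ˢ Metric.closedBall (0 : Fin d → ℝ) r,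
        (∫ w, fderiv ℝ φ (z - w) (1, 0) * u w.1 w.2 = -∫ w, φ (z - w) * β w) ∧
        ∀ i, ∫ w, fderiv ℝ φ (z - w) (0, Pi.single i 1) * u w.1 w.2
          = ∫ w, φ (z - w) * G i w) :
    ∫⁻ x in B, ‖u t₂ (X t₂ x) - u t₁ (X t₁ x)‖ₑ = 0 := by
  have : (volume : Measure (ℝ × (Fin d → ℝ))).IsAddHaarMeasure := by
    rw [Measure.volume_eq_prod]; infer_instance
  set K : Set (ℝ × (Fin d → ℝ)) := Icc t₁ t₂ ×ˢ Metric.closedBall 0 r with hKdef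
  have hK : IsCompact K := isCompact_Icc.prod (isCompact_closedBall _ _)
  set C : ENNReal := c * (1 + d * ENNReal.ofReal M) + 2 * volume B with hCdef
  have hCtop : C ≠ ⊤ := by
    refine ENNReal.add_ne_top.2 ⟨ENNReal.mul_ne_top hc ?_, ENNReal.mul_ne_top (by simp) hB⟩
    exact ENNReal.add_ne_top.2 ⟨by simp, ENNReal.mul_ne_top (by simp) ENNReal.ofReal_ne_top⟩
  suffices H : ∀ δ > (0 : ℝ),
      ∫⁻ x in B, ‖u t₂ (X t₂ x) - u t₁ (X t₁ x)‖ₑ ≤ C * ENNReal.ofReal δ by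
    have ht : Filter.Tendsto (fun δ : ℝ => C * ENNReal.ofReal δ) (nhdsWithin 0 (Ioi 0))
        (nhds 0) := by
      have := ENNReal.Tendsto.const_mul (a := C)
        ((ENNReal.continuous_ofReal.tendsto 0).mono_left
          (nhdsWithin_le_nhds (s := Ioi (0 : ℝ)))) (Or.inr hCtop)
      simpa using this
    exact le_antisymm (ge_of_tendsto ht (Filter.eventually_of_mem self_mem_nhdsWithin H)) bot_le
  intro δ hδ
  have hδ' : 0 < ENNReal.ofReal δ := ENNReal.ofReal_pos.2 hδ
  have htr : ∀ {f : ℝ × (Fin d → ℝ) → ℝ}, Integrable f →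
      ∀ᶠ ε in nhdsWithin (0 : ℝ) (Ioi 0), ∀ w : ℝ × (Fin d → ℝ), ‖w‖ < ε →
        ∫⁻ z, ‖f (z - w) - f z‖ₑ ≤ ENNReal.ofReal δ := by
    intro f hf
    obtain ⟨ε, hε, h⟩ := hf.exists_lintegral_translate_sub_le _ hδ'
    filter_upwards [Ioo_mem_nhdsGT hε] with ε' hε' w hw using h w (hw.trans hε'.2)
  have huu : ∀ᶠ ε in nhdsWithin (0 : ℝ) (Ioi 0), ∀ z ∈ K, ∀ w ∈ Metric.ball z ε,
      dist (u w.1 w.2) (u z.1 z.2) ≤ δ := by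
    have h := hK.uniformContinuousAt_of_continuousAt (fun q : ℝ × (Fin d → ℝ) => u q.1 q.2)
      (fun z _ => huc.continuousAt) (Metric.dist_mem_uniformity hδ)
    obtain ⟨ε, hε, h'⟩ := Metric.mem_uniformity_dist.1 h
    filter_upwards [Ioo_mem_nhdsGT hε] with ε' hε' z hz w hw
    have h3 : dist z w < ε := by
      rw [dist_comm]; exact (Metric.mem_ball.1 hw).trans hε'.2
    have h4 : dist (u z.1 z.2) (u w.1 w.2) < δ := h' h3 hz
    rw [dist_comm]; exact h4.le
  obtain ⟨ε, ⟨φ, hφ, hφs, hφ0, hφε, hφ1, hid⟩, hεβ, hεG, hεu⟩ :=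
    (hmol.and ((htr hβ).and ((Filter.eventually_all.2 fun i => htr (hG i)).and huu))).exists
  set U : ℝ × (Fin d → ℝ) → ℝ := fun z => ∫ w, φ (z - w) * u w.1 w.2 with hUdef
  have hU : ContDiff ℝ 1 U := contDiff_mollify volume hφ hφs huc
  have hUu : ∀ z ∈ K, ‖U z - u z.1 z.2‖ₑ ≤ ENNReal.ofReal δ := fun z hz => by
    have := dist_mollify_le volume hδ.le hφ0 hφε hφ1 huc (hεu z hz)
    rw [← ofReal_norm, ← dist_eq_norm]
    exact ENNReal.ofReal_le_ofReal this
  set e : ℝ × (Fin d → ℝ) → ℝ := fun z => fderiv ℝ U z (1, b z.1 z.2) with hedef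
  have hem : Measurable e := by
    have h3 : Continuous fun p : (ℝ × (Fin d → ℝ)) × (ℝ × (Fin d → ℝ)) => fderiv ℝ U p.1 p.2 :=
      ((hU.continuous_fderiv one_ne_zero).comp continuous_fst).clm_apply continuous_snd
    exact h3.measurable.comp (measurable_id.prodMk (measurable_const.prodMk hbm))
  set Dβ : ℝ × (Fin d → ℝ) → ℝ := fun z => (∫ w, φ (z - w) * β w) - β z
  set D : Fin d → ℝ × (Fin d → ℝ) → ℝ := fun i z => (∫ w, φ (z - w) * G i w) - G i z
  have hconvc : ∀ {f : ℝ × (Fin d → ℝ) → ℝ}, Integrable f →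
      AEStronglyMeasurable (fun z => (∫ w, φ (z - w) * f w) - f z) volume := by
    intro f hf
    have h3 := (hφs.contDiff_convolution_left (n := 1) (ContinuousLinearMap.mul ℝ ℝ) hφ
      hf.locallyIntegrable).continuous
    have h4 : convolution φ f (ContinuousLinearMap.mul ℝ ℝ) volume
        = fun z => ∫ w, φ (z - w) * f w := by
      ext x
      rw [convolution_eq_swap]
      rfl
    rw [h4] at h3
    exact h3.aestronglyMeasurable.sub hf.aestronglyMeasurable
  have hez : ∀ z ∈ K, ‖e z‖ₑ ≤ ‖Dβ z‖ₑ + ∑ i, ENNReal.ofReal M * ‖D i z‖ₑ := by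
    intro z hz
    obtain ⟨A, hA, hAv⟩ := hasFDerivAt_mollify volume hφ hφs huc z
    obtain ⟨hidt, hidx⟩ := hid z hz
    have h3 : ((1 : ℝ), b z.1 z.2) = ((1 : ℝ), (0 : Fin d → ℝ)) +
        ∑ i, b z.1 z.2 i • ((0 : ℝ), (Pi.single i 1 : Fin d → ℝ)) := by
      ext j
      · simp [Prod.fst_sum]
      · simp [Prod.snd_sum, Finset.sum_apply, Pi.single_apply]
    have h4 : e z = -Dβ z + ∑ i, b z.1 z.2 i * D i z := by
      simp only [hedef, Dβ, D]
      rw [hA.fderiv, h3, map_add, map_sum, hAv, hidt, hβG z]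
      have h5 : ∀ i, A (b z.1 z.2 i • ((0 : ℝ), (Pi.single i 1 : Fin d → ℝ))) =
          b z.1 z.2 i * ∫ w, φ (z - w) * G i w := fun i => by
        rw [map_smul, hAv, hidx, smul_eq_mul]
      simp only [h5, mul_sub, Finset.sum_sub_distrib]
      ring
    rw [h4]
    refine (enorm_add_le _ _).trans (add_le_add (enorm_neg _).le ?_)
    refine (enorm_sum_le _ _).trans (Finset.sum_le_sum fun i _ => ?_)
    rw [enorm_mul]
    gcongr
    rw [← ofReal_norm]
    exact ENNReal.ofReal_le_ofReal ((norm_le_pi_norm _ i).trans (hbb _ _))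
  have heK : ∫⁻ z in K, ‖e z‖ₑ ≤ (1 + d * ENNReal.ofReal M) * ENNReal.ofReal δ := by
    calc ∫⁻ z in K, ‖e z‖ₑ
        ≤ ∫⁻ z in K, (‖Dβ z‖ₑ + ∑ i, ENNReal.ofReal M * ‖D i z‖ₑ) :=
          setLIntegral_mono' hK.measurableSet hez
      _ ≤ ∫⁻ z, (‖Dβ z‖ₑ + ∑ i, ENNReal.ofReal M * ‖D i z‖ₑ) := setLIntegral_le_lintegral _ _
      _ = (∫⁻ z, ‖Dβ z‖ₑ) + ∑ i, ENNReal.ofReal M * ∫⁻ z, ‖D i z‖ₑ := by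
          rw [lintegral_add_left' (hconvc hβ).enorm, lintegral_finsetSum' _ fun i _ =>
            ((hconvc (hG i)).enorm.const_mul _)]
          congr 1
          refine Finset.sum_congr rfl fun i _ => ?_
          rw [lintegral_const_mul' _ _ ENNReal.ofReal_ne_top]
      _ ≤ ENNReal.ofReal δ + ∑ _i : Fin d, ENNReal.ofReal M * ENNReal.ofReal δ := by
          gcongr with i
          · exact lintegral_mollify_sub_le volume hβ hεβ hφ.continuous hφs hφ0 hφε hφ1
          · exact lintegral_mollify_sub_le volume (hG i) (hεG i) hφ.continuous hφs hφ0 hφε hφ1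
      _ = _ := by
          rw [Finset.sum_const, Finset.card_univ, Fintype.card_fin, nsmul_eq_mul]
          ring
  have hXs : ∀ x, Continuous fun s => X s x := fun x =>
    hXc.comp (continuous_id.prodMk continuous_const)
  have hXt : ∀ s, Continuous (X s) := fun s => hXc.comp (continuous_const.prodMk continuous_id)
  have hUX : ∫⁻ x in B, ‖U (t₂, X t₂ x) - U (t₁, X t₁ x)‖ₑ
      ≤ c * ((1 + d * ENNReal.ofReal M) * ENNReal.ofReal δ) := by
    have hmeas : Measurable fun p : (Fin d → ℝ) × ℝ => ‖e (p.2, X p.2 p.1)‖ₑ :=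
      (hem.comp (measurable_snd.prodMk (hXc.measurable.comp measurable_swap))).enorm
    calc ∫⁻ x in B, ‖U (t₂, X t₂ x) - U (t₁, X t₁ x)‖ₑ
        ≤ ∫⁻ x in B, ∫⁻ s in Icc t₁ t₂, ‖e (s, X s x)‖ₑ := by
          refine lintegral_mono fun x => ?_
          have hm : Measurable fun s => b s (X s x) :=
            hbm.comp (measurable_id.prodMk (hXs x).measurable)
          have h3 := sub_eq_integral_fderiv_of_integral_curve hU hm.aestronglyMeasurable
            (fun s => hbb s (X s x)) (hflow x) h1 h12 h2
          rw [h3, intervalIntegral.integral_of_le h12]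
          exact (enorm_integral_le_lintegral_enorm _).trans
            (lintegral_mono_set Ioc_subset_Icc_self)
      _ = ∫⁻ s in Icc t₁ t₂, ∫⁻ x in B, ‖e (s, X s x)‖ₑ :=
          lintegral_lintegral_swap hmeas.aemeasurable
      _ ≤ ∫⁻ s in Icc t₁ t₂, c * ∫⁻ y in Metric.closedBall 0 r, ‖e (s, y)‖ₑ := by
          refine setLIntegral_mono' measurableSet_Icc fun s hs => ?_
          have hes : Measurable fun y => ‖e (s, y)‖ₑ :=
            (hem.comp (measurable_const.prodMk measurable_id)).enorm
          rw [← lintegral_map (f := fun y => ‖e (s, y)‖ₑ) hes (hXt s).measurable,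
            ← smul_eq_mul, ← lintegral_smul_measure]
          exact lintegral_mono' (hmap s hs) le_rfl
      _ = c * ∫⁻ z in K, ‖e z‖ₑ := by
          rw [lintegral_const_mul' _ _ hc, hKdef, Measure.volume_eq_prod,
            setLIntegral_prod _ hem.enorm.aemeasurable]
      _ ≤ _ := by gcongr
  have hUm : ∀ t, Measurable fun x => U (t, X t x) := fun t =>
    (hU.continuous.comp (continuous_const.prodMk (hXt t))).measurable
  calc ∫⁻ x in B, ‖u t₂ (X t₂ x) - u t₁ (X t₁ x)‖ₑ
      ≤ ∫⁻ x in B, (‖U (t₂, X t₂ x) - U (t₁, X t₁ x)‖ₑ + 2 * ENNReal.ofReal δ) := by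
        refine setLIntegral_mono' hBm fun x hx => ?_
        have h3 := hUu (t₂, X t₂ x) ⟨⟨h12, le_rfl⟩, hBr t₂ ⟨h12, le_rfl⟩ hx⟩
        have h4 := hUu (t₁, X t₁ x) ⟨⟨le_rfl, h12⟩, hBr t₁ ⟨le_rfl, h12⟩ hx⟩
        have h5 : u t₂ (X t₂ x) - u t₁ (X t₁ x) = (U (t₂, X t₂ x) - U (t₁, X t₁ x)) +
            (-(U (t₂, X t₂ x) - u t₂ (X t₂ x)) + (U (t₁, X t₁ x) - u t₁ (X t₁ x))) := by ring
        rw [h5, two_mul]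
        refine (enorm_add_le _ _).trans (add_le_add le_rfl ?_)
        exact (enorm_add_le _ _).trans (add_le_add ((enorm_neg _).le.trans h3) h4)
    _ = (∫⁻ x in B, ‖U (t₂, X t₂ x) - U (t₁, X t₁ x)‖ₑ) + 2 * ENNReal.ofReal δ * volume B := by
        have hm : Measurable fun x => ‖U (t₂, X t₂ x) - U (t₁, X t₁ x)‖ₑ :=
          ((hUm t₂).sub (hUm t₁)).enorm
        rw [lintegral_add_left hm, setLIntegral_const]
    _ ≤ c * ((1 + d * ENNReal.ofReal M) * ENNReal.ofReal δ) + 2 * ENNReal.ofReal δ * volume B := by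
        gcongr
    _ = C * ENNReal.ofReal δ := by rw [hCdef]; ring

/-- Tensor product mollifiers turn the weak formulation of the transport equation into identities
for the derivatives of the mollified solution. -/
theorem eventually_exists_mollifier_of_weak_solution {d : ℕ} {T r t₁ t₂ : ℝ} (h1 : 0 < t₁)
    (h2 : t₂ < T) {b : ℝ → (Fin d → ℝ) → (Fin d → ℝ)} {u : ℝ → (Fin d → ℝ) → ℝ}
    {Du : ℝ → (Fin d → ℝ) → (Fin d → ℝ)}
    (huc : Continuous fun q : ℝ × (Fin d → ℝ) => u q.1 q.2)
    (hweakgrad : ∀ ψ : ℝ × (Fin d → ℝ) → ℝ, ContDiff ℝ (⊤ : ℕ∞) ψ → HasCompactSupport ψ →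
      tsupport ψ ⊆ Ioo 0 T ×ˢ univ → ∀ i : Fin d,
        ∫ q : ℝ × (Fin d → ℝ), fderiv ℝ ψ q (0, Pi.single i 1) * u q.1 q.2 =
          -∫ q : ℝ × (Fin d → ℝ), ψ q * Du q.1 q.2 i)
    (hweak : ∀ ρ : ℝ → ℝ, ContDiff ℝ (⊤ : ℕ∞) ρ → HasCompactSupport ρ →
      tsupport ρ ⊆ Ioo 0 T →
      ∀ η : (Fin d → ℝ) → ℝ, ContDiff ℝ (⊤ : ℕ∞) η → HasCompactSupport η →
        ∫ t in Icc (0 : ℝ) T, ∫ x,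
          (-(u t x * deriv ρ t * η x) +
            (∑ i, b t x i * Du t x i) * ρ t * η x) = 0)
    {G : Fin d → ℝ × (Fin d → ℝ) → ℝ} {β : ℝ × (Fin d → ℝ) → ℝ} (hβ : Integrable β)
    (hGD : ∀ z ∈ Icc 0 T ×ˢ Metric.closedBall (0 : Fin d → ℝ) (r + 1), ∀ i,
      G i z = Du z.1 z.2 i)
    (hβD : ∀ z ∈ Icc 0 T ×ˢ Metric.closedBall (0 : Fin d → ℝ) (r + 1),
      β z = ∑ i, b z.1 z.2 i * Du z.1 z.2 i) :
    ∀ᶠ ε in nhdsWithin (0 : ℝ) (Ioi 0), ∃ φ : ℝ × (Fin d → ℝ) → ℝ,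
      ContDiff ℝ 1 φ ∧ HasCompactSupport φ ∧ (∀ w, 0 ≤ φ w) ∧
      Function.support φ ⊆ Metric.ball 0 ε ∧ ∫ w, φ w = 1 ∧
      ∀ z ∈ Icc t₁ t₂ ×ˢ Metric.closedBall (0 : Fin d → ℝ) r,
        (∫ w, fderiv ℝ φ (z - w) (1, 0) * u w.1 w.2 = -∫ w, φ (z - w) * β w) ∧
        ∀ i, ∫ w, fderiv ℝ φ (z - w) (0, Pi.single i 1) * u w.1 w.2
          = ∫ w, φ (z - w) * G i w := by
  have : (volume : Measure (ℝ × (Fin d → ℝ))).IsAddHaarMeasure := by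
    rw [Measure.volume_eq_prod]; infer_instance
  have hpos : 0 < min 1 (min t₁ (T - t₂)) := by
    simp only [lt_min_iff]
    exact ⟨one_pos, h1, by linarith⟩
  filter_upwards [Ioo_mem_nhdsGT hpos] with ε ⟨hε, hεlt⟩
  simp only [lt_min_iff] at hεlt
  obtain ⟨hε1, hεt₁, hεt₂⟩ := hεlt
  obtain ⟨ρ, hρ, hρs, hρ0, hρε, hρ1⟩ := exists_smooth_mollifier (volume : Measure ℝ) hε
  obtain ⟨η, hη, hηs, hη0, hηε, hη1⟩ :=
    exists_smooth_mollifier (volume : Measure (Fin d → ℝ)) hε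
  set φ : ℝ × (Fin d → ℝ) → ℝ := fun w => ρ w.1 * η w.2 with hφdef
  have hφ : ContDiff ℝ (⊤ : ℕ∞) φ := (hρ.comp contDiff_fst).mul (hη.comp contDiff_snd)
  have hφε : Function.support φ ⊆ Metric.ball 0 ε := fun w hw => by
    have h3 := hρε (left_ne_zero_of_mul hw)
    have h4 := hηε (right_ne_zero_of_mul hw)
    rw [mem_ball_zero_iff] at h3 h4 ⊢
    exact max_lt h3 h4
  have hφs : HasCompactSupport φ :=
    HasCompactSupport.intro (isCompact_closedBall 0 ε) fun w hw => by
      by_contra h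
      exact hw (Metric.ball_subset_closedBall (hφε h))
  have hdρ : ∀ w : ℝ × (Fin d → ℝ), fderiv ℝ φ w (1, 0) = deriv ρ w.1 * η w.2 := fun w => by
    have h3 : HasFDerivAt (fun w : ℝ × (Fin d → ℝ) => ρ w.1) _ w :=
      ((hρ.differentiable (by simp)).differentiableAt.hasFDerivAt (x := w.1)).comp w
        hasFDerivAt_fst
    have h4 : HasFDerivAt (fun w : ℝ × (Fin d → ℝ) => η w.2) _ w :=
      ((hη.differentiable (by simp)).differentiableAt.hasFDerivAt (x := w.2)).comp w
        hasFDerivAt_snd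
    have h5 : HasFDerivAt φ _ w := h3.mul h4
    rw [h5.fderiv]
    simp [mul_comm]
  refine ⟨φ, hφ.of_le (by simp), hφs, fun w => mul_nonneg (hρ0 _) (hη0 _), hφε, ?_, ?_⟩
  · rw [Measure.volume_eq_prod, hφdef, integral_prod_mul, hρ1, hη1, one_mul]
  intro z hz
  have hmem : ∀ w, φ (z - w) ≠ 0 →
      w ∈ Icc 0 T ×ˢ Metric.closedBall (0 : Fin d → ℝ) (r + 1) := fun w hw => by
    have h3 := mem_ball_zero_iff.1 (hφε hw)
    have h4 : |z.1 - w.1| < ε := (le_max_left _ _).trans_lt h3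
    have h5 : ‖z.2 - w.2‖ < ε := (le_max_right _ _).trans_lt h3
    obtain ⟨⟨hz1, hz2⟩, hz3⟩ := hz
    rw [mem_closedBall_zero_iff] at hz3
    rw [abs_lt] at h4
    refine ⟨⟨by linarith, by linarith⟩, mem_closedBall_zero_iff.2 ?_⟩
    have h6 : ‖w.2‖ ≤ ‖z.2‖ + ‖z.2 - w.2‖ := norm_le_insert _ _
    linarith
  have hρt : tsupport (fun s => ρ (z.1 - s)) ⊆ Ioo 0 T := by
    have h3 : tsupport (fun s => ρ (z.1 - s)) ⊆ Metric.closedBall z.1 ε := by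
      refine closure_minimal (fun s hs => ?_) Metric.isClosed_closedBall
      have h4 := mem_ball_zero_iff.1 (hρε hs)
      rw [Metric.mem_closedBall, dist_comm, dist_eq_norm]
      exact h4.le
    refine h3.trans fun s hs => ?_
    rw [Real.closedBall_eq_Icc] at hs
    obtain ⟨⟨hz1, hz2⟩, -⟩ := hz
    exact ⟨by linarith [hs.1], by linarith [hs.2]⟩
  constructor
  · have hρ' : ∀ s, deriv (fun s => ρ (z.1 - s)) s = -deriv ρ (z.1 - s) := fun s =>
      deriv_comp_const_sub _ _ _
    have h3 := hweak (fun s => ρ (z.1 - s)) (hρ.comp (contDiff_const.sub contDiff_id))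
      (hρs.comp_homeomorph (Homeomorph.subLeft z.1)) hρt (fun y => η (z.2 - y))
      (hη.comp (contDiff_const.sub contDiff_id))
      (hηs.comp_homeomorph (Homeomorph.subLeft z.2))
    have hi1 : Integrable fun w : ℝ × (Fin d → ℝ) =>
        fderiv ℝ φ (z - w) (1, 0) * u w.1 w.2 := by
      refine Continuous.integrable_of_hasCompactSupport ?_ ?_
      · exact (((hφ.continuous_fderiv (by simp)).comp
          (continuous_const.sub continuous_id)).clm_apply continuous_const).mul huc
      · exact ((hφs.fderiv_apply (𝕜 := ℝ) (1, 0)).comp_homeomorph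
          (Homeomorph.subLeft z)).mul_right
    have hi2 : Integrable fun w => φ (z - w) * β w := by
      obtain ⟨C, hC⟩ := hφ.continuous.bounded_above_of_compact_support hφs
      exact hβ.bdd_mul (hφ.continuous.comp
        (continuous_const.sub continuous_id)).aestronglyMeasurable
        (Filter.Eventually.of_forall fun w => hC (z - w))
    have h4 : ∀ t ∈ Icc 0 T, ∀ x, -(u t x * deriv (fun s => ρ (z.1 - s)) t * η (z.2 - x)) +
        (∑ i, b t x i * Du t x i) * ρ (z.1 - t) * η (z.2 - x) =
        fderiv ℝ φ (z - (t, x)) (1, 0) * u t x + φ (z - (t, x)) * β (t, x) := fun t _ x => by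
      have h5 : φ (z - (t, x)) * β (t, x) =
          φ (z - (t, x)) * ∑ i, b t x i * Du t x i := by
        by_cases h : φ (z - (t, x)) = 0
        · rw [h, zero_mul, zero_mul]
        · rw [hβD _ (hmem _ h)]
      rw [h5, hdρ, hρ']
      simp only [hφdef, Prod.fst_sub, Prod.snd_sub]
      ring
    rw [setIntegral_congr_fun measurableSet_Icc fun t ht => integral_congr_ae
      (Filter.Eventually.of_forall (h4 t ht)), setIntegral_eq_integral_of_forall_compl_eq_zero]
      at h3
    · have h5 : ∫ w, (fderiv ℝ φ (z - w) (1, 0) * u w.1 w.2 + φ (z - w) * β w) = 0 :=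
        (integral_prod _ (hi1.add hi2)).trans h3
      rw [integral_add hi1 hi2] at h5
      linarith
    · intro t ht
      have ht' : t ∉ tsupport (fun s => ρ (z.1 - s)) := fun h => ht (Ioo_subset_Icc_self (hρt h))
      have h6 : ρ (z.1 - t) = 0 := image_eq_zero_of_notMem_tsupport (f := fun s => ρ (z.1 - s)) ht'
      have h7 : deriv ρ (z.1 - t) = 0 := by
        have h8 : deriv (fun s => ρ (z.1 - s)) t = 0 := by
          by_contra h
          exact ht' (support_deriv_subset h)
        rw [hρ'] at h8
        exact neg_eq_zero.1 h8
      have h8 : ∀ x, φ (z - (t, x)) = 0 := fun x => by simp [hφdef, h6]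
      simp [hdρ, h7, h8]
  · intro i
    have h3 := hweakgrad (fun w => φ (z - w)) (hφ.comp (contDiff_const.sub contDiff_id))
      (hφs.comp_homeomorph (Homeomorph.subLeft z)) ?_ i
    · have h4 : ∀ w, fderiv ℝ (fun w => φ (z - w)) w (0, Pi.single i 1) =
          -fderiv ℝ φ (z - w) (0, Pi.single i 1) := fun w => by
        have h5 : HasFDerivAt (fun w => φ (z - w)) _ w :=
          ((hφ.differentiable (by simp)).differentiableAt.hasFDerivAt (x := z - w)).comp w
            ((hasFDerivAt_id w).const_sub z)
        rw [h5.fderiv]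
        simp
      simp only [h4, neg_mul, integral_neg, neg_inj] at h3
      rw [h3]
      refine integral_congr_ae (Filter.Eventually.of_forall fun w => ?_)
      by_cases h : φ (z - w) = 0
      · simp [h]
      · simp only [hGD w (hmem w h)]
    · refine (closure_mono (t := Prod.fst ⁻¹' Function.support fun s => ρ (z.1 - s))
        fun w hw => left_ne_zero_of_mul hw).trans fun w hw => ⟨hρt ?_, mem_univ _⟩
      exact continuous_fst.closure_preimage_subset _ hw

/-- Uniqueness for the transport equation via a Lipschitz inverse flow: if `b*` is bounded
measurable, `X̂` is a continuous flow of the ODE driven by `b*` with continuous inverse flow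
`Ŷ ∈ W^{1,∞}_loc` (locally Lipschitz, i.e. with essentially bounded Jacobian), then every weak
`W^{1,p}_loc` solution `u` (with `p > d`) of `∂_t u + b*·∇u = 0`, `u(0,·) = u₀`, is constant
along the characteristics and equals `u₀ ∘ Ŷ`; in particular it is unique. -/
theorem transport_equation_uniqueness (d : ℕ) (T M p : ℝ) (hT : 0 < T) (hp : (d : ℝ) < p)
    (bstar : ℝ → (Fin d → ℝ) → (Fin d → ℝ))
    (hbm : Measurable (Function.uncurry bstar)) (hbb : ∀ t x, ‖bstar t x‖ ≤ M)
    -- the flow `X̂` and its inverse `Ŷ`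
    (Xhat Yhat : ℝ → (Fin d → ℝ) → (Fin d → ℝ))
    (hXc : Continuous fun q : ℝ × (Fin d → ℝ) => Xhat q.1 q.2)
    (hYc : Continuous fun q : ℝ × (Fin d → ℝ) => Yhat q.1 q.2)
    (hflow : ∀ x, ∀ t ∈ Icc (0 : ℝ) T,
      Xhat t x = x + ∫ u in Ioc 0 t, bstar u (Xhat u x))
    (hinv : ∀ t ∈ Icc (0 : ℝ) T, ∀ x, Yhat t (Xhat t x) = x)
    -- `Ŷ ∈ W^{1,∞}_loc`: locally Lipschitz in `(t,x)`
    (hYlip : ∀ K : Set (ℝ × (Fin d → ℝ)), IsCompact K →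
      ∃ L : NNReal, LipschitzOnWith L (fun q : ℝ × (Fin d → ℝ) => Yhat q.1 q.2) K)
    -- the weak solution `u` with spatial weak gradient `Du`, initial datum `u₀`
    (u : ℝ → (Fin d → ℝ) → ℝ) (u0 : (Fin d → ℝ) → ℝ) (hu0c : Continuous u0)
    (Du : ℝ → (Fin d → ℝ) → (Fin d → ℝ))
    (huc : Continuous fun q : ℝ × (Fin d → ℝ) => u q.1 q.2)
    (hu0 : ∀ x, u 0 x = u0 x)
    (hDuloc : LocallyIntegrableOn (fun q : ℝ × (Fin d → ℝ) => Du q.1 q.2)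
      (Icc 0 T ×ˢ univ) volume)
    (hDup : ∀ K : Set (ℝ × (Fin d → ℝ)), K ⊆ Icc 0 T ×ˢ univ → IsCompact K →
      IntegrableOn (fun q : ℝ × (Fin d → ℝ) => ‖Du q.1 q.2‖ ^ p) K)
    -- `Du` is the spatial weak gradient of `u` on `(0,T) × ℝ^d`
    (hweakgrad : ∀ ψ : ℝ × (Fin d → ℝ) → ℝ, ContDiff ℝ (⊤ : ℕ∞) ψ → HasCompactSupport ψ →
      tsupport ψ ⊆ Ioo 0 T ×ˢ univ → ∀ i : Fin d,
        ∫ q : ℝ × (Fin d → ℝ), fderiv ℝ ψ q (0, Pi.single i 1) * u q.1 q.2 =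
          -∫ q : ℝ × (Fin d → ℝ), ψ q * Du q.1 q.2 i)
    -- the weak formulation of the transport equation
    (hweak : ∀ ρ : ℝ → ℝ, ContDiff ℝ (⊤ : ℕ∞) ρ → HasCompactSupport ρ →
      tsupport ρ ⊆ Ioo 0 T →
      ∀ η : (Fin d → ℝ) → ℝ, ContDiff ℝ (⊤ : ℕ∞) η → HasCompactSupport η →
        ∫ t in Icc (0 : ℝ) T, ∫ x,
          (-(u t x * deriv ρ t * η x) +
            (∑ i, bstar t x i * Du t x i) * ρ t * η x) = 0) :
    (∀ x, ∀ t₁ ∈ Icc (0 : ℝ) T, ∀ t₂ ∈ Icc (0 : ℝ) T,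
      u t₁ (Xhat t₁ x) = u t₂ (Xhat t₂ x)) ∧
    ∀ t ∈ Icc (0 : ℝ) T, ∀ x, u t x = u0 (Yhat t x) := by
  have hM : 0 ≤ M := (norm_nonneg _).trans (hbb 0 0)
  have hXs : ∀ x, Continuous fun s => Xhat s x := fun x =>
    hXc.comp (continuous_id.prodMk continuous_const)
  have hXt : ∀ s, Continuous (Xhat s) := fun s =>
    hXc.comp (continuous_const.prodMk continuous_id)
  have hdist : ∀ t ∈ Icc (0 : ℝ) T, ∀ x, ‖Xhat t x - x‖ ≤ M * T := by
    intro t ht x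
    rw [hflow x t ht, add_sub_cancel_left]
    calc ‖∫ s in Ioc 0 t, bstar s (Xhat s x)‖
        ≤ M * volume.real (Ioc 0 t) :=
          norm_setIntegral_le_of_norm_le_const (by simp) fun s _ => hbb _ _
      _ = M * t := by rw [Real.volume_real_Ioc_of_le ht.1, sub_zero]
      _ ≤ M * T := mul_le_mul_of_nonneg_left ht.2 hM
  have key : ∀ t₁ t₂, 0 < t₁ → t₁ ≤ t₂ → t₂ < T → ∀ x,
      u t₂ (Xhat t₂ x) = u t₁ (Xhat t₁ x) := by
    intro t₁ t₂ h1 h12 h2 x₀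
    set B : Set (Fin d → ℝ) := Metric.ball 0 (‖x₀‖ + 1) with hB
    set r : ℝ := ‖x₀‖ + 1 + M * T with hr
    have hsub : Icc t₁ t₂ ⊆ Icc 0 T := Icc_subset_Icc h1.le h2.le
    have hBr : ∀ t ∈ Icc t₁ t₂, MapsTo (Xhat t) B (Metric.closedBall 0 r) := fun t ht x hx => by
      have h3 := hdist t (hsub ht) x
      rw [hB, mem_ball_zero_iff] at hx
      rw [mem_closedBall_zero_iff, hr]
      have h4 : ‖Xhat t x‖ ≤ ‖x‖ + ‖Xhat t x - x‖ := norm_le_insert' _ _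
      linarith
    set K : Set (ℝ × (Fin d → ℝ)) := Icc 0 T ×ˢ Metric.closedBall 0 (r + 1)
    have hK : IsCompact K := isCompact_Icc.prod (isCompact_closedBall _ _)
    obtain ⟨L, hL⟩ := hYlip K hK
    have hLt : ∀ t ∈ Icc (0 : ℝ) T, LipschitzOnWith L (Yhat t) (Metric.closedBall 0 r) := by
      intro t ht x hx y hy
      have hrr : Metric.closedBall (0 : Fin d → ℝ) r ⊆ Metric.closedBall 0 (r + 1) :=
        Metric.closedBall_subset_closedBall (by linarith)
      have h3 := hL (x := (t, x)) ⟨ht, hrr hx⟩ (y := (t, y)) ⟨ht, hrr hy⟩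
      simpa [Prod.edist_eq] using h3
    have hDuK : IntegrableOn (fun q : ℝ × (Fin d → ℝ) => Du q.1 q.2) K :=
      hDuloc.integrableOn_compact_subset (prod_mono Subset.rfl (subset_univ _)) hK
    set G : Fin d → ℝ × (Fin d → ℝ) → ℝ := fun i => K.indicator fun q => Du q.1 q.2 i
    have hG : ∀ i, Integrable (G i) := fun i =>
      (integrable_indicator_iff hK.measurableSet).2 (hDuK.eval i)
    set β : ℝ × (Fin d → ℝ) → ℝ := fun z => ∑ i, bstar z.1 z.2 i * G i z with hβdef
    have hβ : Integrable β := integrable_finsetSum _ fun i _ => by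
      refine (hG i).bdd_mul (c := M) ?_ (Filter.Eventually.of_forall fun z => ?_)
      · exact ((measurable_pi_apply i).comp hbm).aestronglyMeasurable
      · exact (norm_le_pi_norm _ i).trans (hbb _ _)
    have hGD : ∀ z ∈ K, ∀ i, G i z = Du z.1 z.2 i := fun z hz i => indicator_of_mem hz _
    have hβD : ∀ z ∈ K, β z = ∑ i, bstar z.1 z.2 i * Du z.1 z.2 i := fun z hz => by
      simp only [hβdef, hGD z hz]
    have h0 := lintegral_sub_along_flow_eq_zero h1.le h12 h2.le hbm hbb hXc hflow
      measure_ball_lt_top.ne (c := (L : ENNReal) ^ d) (by simp) hBr measurableSet_ball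
      (fun t ht => map_restrict_le_of_lipschitzOnWith_leftInverse (hXt t).measurable
        (hinv t (hsub ht)) (hLt t (hsub ht)) (hBr t ht)) huc hG hβ (fun z => rfl)
      (eventually_exists_mollifier_of_weak_solution h1 h2 huc hweakgrad hweak hβ hGD hβD)
    have hcont : ∀ t, Continuous fun x => u t (Xhat t x) := fun t =>
      huc.comp (continuous_const.prodMk (hXt t))
    have hmeas : Measurable fun x => ‖u t₂ (Xhat t₂ x) - u t₁ (Xhat t₁ x)‖ₑ :=
      ((hcont t₂).sub (hcont t₁)).measurable.enorm
    rw [lintegral_eq_zero_iff hmeas] at h0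
    have hae : (fun x => u t₂ (Xhat t₂ x)) =ᵐ[volume.restrict B] fun x => u t₁ (Xhat t₁ x) := by
      filter_upwards [h0] with x hx
      exact sub_eq_zero.1 (enorm_eq_zero.1 hx)
    exact Measure.eqOn_open_of_ae_eq hae Metric.isOpen_ball (hcont t₂).continuousOn
      (hcont t₁).continuousOn (mem_ball_zero_iff.2 (lt_add_one _))
  have hconst : ∀ x, ∀ t ∈ Icc (0 : ℝ) T, u t (Xhat t x) = u (T / 2) (Xhat (T / 2) x) := by
    intro x
    have h3 : EqOn (fun t => u t (Xhat t x)) (fun _ => u (T / 2) (Xhat (T / 2) x)) (Ioo 0 T) := by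
      intro t ht
      rcases le_total (T / 2) t with h | h
      · exact key _ _ (by linarith) h ht.2 x
      · exact (key _ _ ht.1 h (by linarith) x).symm
    have h4 := h3.closure (huc.comp (continuous_id.prodMk (hXs x))) continuous_const
    rwa [closure_Ioo hT.ne] at h4
  refine ⟨fun x t₁ ht₁ t₂ ht₂ => (hconst x t₁ ht₁).trans (hconst x t₂ ht₂).symm,
    fun t ht y => ?_⟩
  have h0 : (0 : ℝ) ∈ Icc 0 T := ⟨le_rfl, hT.le⟩
  obtain ⟨x, rfl⟩ := surjective_of_dist_id_le (hXt t) (hdist t ht) y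
  have hX0 : Xhat 0 x = x := by simpa using hflow x 0 h0
  rw [hinv t ht x, hconst x t ht, ← hconst x 0 h0, hX0, hu0]
end
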